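/- Let d ≥ 1 and let the pair (s,k) satisfy either ( −d/2 < s < min(d/2 − 2/(k−1), 0) and k > 1 + 2/d ) or ( s ≤ −d/2 and k ≥ 5 ), where k ≥ 2 is an integer. Fix Schwartz functions (u₀,u₁) on ℝ^d. Then for every n ∈ ℕ there exist initial data (v₀,v₁) ∈ F⃗L¹, a time T > 0, a Duhamel solution u_n ∈ C([0,T]; FL^{0,1}(ℝ^d)) of vNLW with initial data (v₀,v₁), and a time t_n ∈ (0, 1/n) with t_n ≤ T, such that ‖(v₀,v₁) − (u₀,u₁)‖_{𝓗^s} < 1/n and ‖u_n(t_n)‖_{H^s} > n. -/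

import Mathlib

open MeasureTheory Real Set Filter Topology
open scoped ENNReal NNReal BigOperators

noncomputable section

/-- Frequency space `ℝ^d` with the Euclidean norm. -/
abbrev Edim (d : ℕ) := EuclideanSpace ℝ (Fin d)

/-! We work entirely on the Fourier side: a function `f` on `ℝ^d` is represented by
its Fourier transform `F = f̂ : ℝ^d → ℂ`. -/

/-- Squared `H^s` norm, computed on the Fourier side:
`‖f‖_{H^s}² = ∫ ⟨ξ⟩^{2s} |f̂(ξ)|² dξ`. -/
def HsNormSq (d : ℕ) (s : ℝ) (F : Edim d → ℂ) : ℝ≥0∞ :=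
  ∫⁻ ξ, ENNReal.ofReal ((1 + ‖ξ‖ ^ 2) ^ s * ‖F ξ‖ ^ 2)

/-- `H^s` norm on the Fourier side. -/
def HsNorm (d : ℕ) (s : ℝ) (F : Edim d → ℂ) : ℝ≥0∞ :=
  HsNormSq d s F ^ (1 / 2 : ℝ)

/-- Norm of `𝓗^s = H^s × H^{s-1}` on the Fourier side. -/
def pairHsNorm (d : ℕ) (s : ℝ) (F G : Edim d → ℂ) : ℝ≥0∞ :=
  (HsNormSq d s F + HsNormSq d (s - 1) G) ^ (1 / 2 : ℝ)

/-- Membership in `H^s`, on the Fourier side. -/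
def MemHs (d : ℕ) (s : ℝ) (F : Edim d → ℂ) : Prop :=
  Measurable F ∧ HsNormSq d s F < ⊤

/-- Membership in `𝓗^s = H^s × H^{s-1}`, on the Fourier side. -/
def MemHsPair (d : ℕ) (s : ℝ) (F G : Edim d → ℂ) : Prop :=
  MemHs d s F ∧ MemHs d (s - 1) G

/-- The Wiener-algebra norm `‖f‖_{FL^{0,1}} = ‖f̂‖_{L¹}`, on the Fourier side. -/
def FLNorm (d : ℕ) (F : Edim d → ℂ) : ℝ≥0∞ :=
  ∫⁻ ξ, (‖F ξ‖₊ : ℝ≥0∞)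

/-- The norm `‖g‖_{FL^{-1,1}} = ‖⟨ξ⟩⁻¹ ĝ‖_{L¹}`, on the Fourier side. -/
def FLm1Norm (d : ℕ) (F : Edim d → ℂ) : ℝ≥0∞ :=
  ∫⁻ ξ, ENNReal.ofReal ((1 + ‖ξ‖ ^ 2) ^ (-(1 : ℝ) / 2) * ‖F ξ‖)

/-- Norm of `F⃗L¹ = FL^{0,1} × FL^{-1,1}`. -/
def pairFLNorm (d : ℕ) (F G : Edim d → ℂ) : ℝ≥0∞ :=
  FLNorm d F + FLm1Norm d G

/-- Membership in `F⃗L¹ = FL^{0,1} × FL^{-1,1}`, on the Fourier side. -/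
def MemFLPair (d : ℕ) (F G : Edim d → ℂ) : Prop :=
  Measurable F ∧ Measurable G ∧ pairFLNorm d F G < ⊤

/-- Symbol of `V₀(t)`: `cos((√3/2)|ξ|t) + (1/√3) sin((√3/2)|ξ|t)`. -/
def V0sym (t r : ℝ) : ℝ :=
  Real.cos (Real.sqrt 3 / 2 * r * t) + 1 / Real.sqrt 3 * Real.sin (Real.sqrt 3 / 2 * r * t)

/-- Symbol of `V₁(t)`: `sin((√3/2)|ξ|t) / ((√3/2)|ξ|)`. -/
def V1sym (t r : ℝ) : ℝ :=
  Real.sin (Real.sqrt 3 / 2 * r * t) / (Real.sqrt 3 / 2 * r)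

/-- Symbol of the Poisson kernel `P(t)`: `e^{-|ξ|t/2}`. -/
def Psym (t r : ℝ) : ℝ := Real.exp (-(r * t) / 2)

/-- Symbol of `W(t) = P(t)V₁(t)`. -/
def Wsym (t r : ℝ) : ℝ := Psym t r * V1sym t r

/-- Fourier side of the linear flow `V(t)(u₀,u₁) = P(t)(V₀(t)u₀ + V₁(t)u₁)`. -/
def Vflow (d : ℕ) (F₀ F₁ : Edim d → ℂ) (t : ℝ) (ξ : Edim d) : ℂ :=
  ((Psym t ‖ξ‖ * V0sym t ‖ξ‖ : ℝ) : ℂ) * F₀ ξ + ((Psym t ‖ξ‖ * V1sym t ‖ξ‖ : ℝ) : ℂ) * F₁ ξ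

/-- Convolution on `ℝ^d`. -/
def conv (d : ℕ) (f g : Edim d → ℂ) (ξ : Edim d) : ℂ :=
  ∫ η, f (ξ - η) * g η

/-- `convIter d f n` is the `(n+1)`-fold convolution `f ∗ ⋯ ∗ f`. -/
def convIter (d : ℕ) (f : Edim d → ℂ) : ℕ → Edim d → ℂ
  | 0 => f
  | n + 1 => conv d (convIter d f n) f

/-- Convolution of a (nonempty) list of functions. -/
def listConv (d : ℕ) : List (Edim d → ℂ) → Edim d → ℂ
  | [] => fun _ => 0
  | f :: fs => fs.foldl (conv d) f

/-- Fourier side of the Duhamel operator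
`I_k(u₁,…,u_k)(t) = -∫₀ᵗ W(t-t') ∏ u_j(t') dt'`. -/
def Ik (d k : ℕ) (us : Fin k → ℝ → Edim d → ℂ) (t : ℝ) (ξ : Edim d) : ℂ :=
  -(∫ t' in (0 : ℝ)..t,
      ((Wsym (t - t') ‖ξ‖ : ℝ) : ℂ) * listConv d (List.ofFn fun i => us i t') ξ)

/-- Picard iterates `Ξ_j` of vNLW, on the Fourier side:
`Ξ₀(u⃗₀)(t) = V(t)u⃗₀` and
`Ξ_j(u⃗₀) = ∑_{j₁+⋯+j_k = j-1} I_k(Ξ_{j₁}(u⃗₀),…,Ξ_{j_k}(u⃗₀))`. -/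
def Xi (d k : ℕ) (F₀ F₁ : Edim d → ℂ) : ℕ → ℝ → Edim d → ℂ
  | 0 => Vflow d F₀ F₁
  | j + 1 => fun t ξ =>
      ∑ l ∈ (Finset.Nat.antidiagonalTuple k j).attach,
        Ik d k (fun i => Xi d k F₀ F₁ (l.1 i)) t ξ
  decreasing_by
    have h := Finset.Nat.mem_antidiagonalTuple.mp l.2
    have hle := Finset.single_le_sum (f := l.1) (fun j _ => Nat.zero_le (l.1 j))
      (Finset.mem_univ i)
    omega

/-- `u : [0,T] → FL^{0,1}(ℝ^d)` (represented on the Fourier side) is a Duhamel solution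
of vNLW with nonlinearity `-u^k` and initial data `(u₀,u₁)` with `û₀ = F₀`, `û₁ = F₁`. -/
structure IsDuhamelSolution (d k : ℕ) (T : ℝ) (F₀ F₁ : Edim d → ℂ)
    (u : ℝ → Edim d → ℂ) : Prop where
  measurable : ∀ t ∈ Set.Icc (0 : ℝ) T, Measurable (u t)
  finite : ∀ t ∈ Set.Icc (0 : ℝ) T, FLNorm d (u t) < ⊤
  continuous : ∀ t₀ ∈ Set.Icc (0 : ℝ) T, ∀ ε : ℝ, 0 < ε → ∃ δ : ℝ, 0 < δ ∧
    ∀ t ∈ Set.Icc (0 : ℝ) T, |t - t₀| < δ →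
      FLNorm d (fun ξ => u t ξ - u t₀ ξ) < ENNReal.ofReal ε
  duhamel : ∀ t ∈ Set.Icc (0 : ℝ) T, ∀ᵐ ξ : Edim d, u t ξ =
    ((Psym t ‖ξ‖ * V0sym t ‖ξ‖ : ℝ) : ℂ) * F₀ ξ
      + ((Psym t ‖ξ‖ * V1sym t ‖ξ‖ : ℝ) : ℂ) * F₁ ξ
      - ∫ t' in (0 : ℝ)..t,
          ((Wsym (t - t') ‖ξ‖ : ℝ) : ℂ) * convIter d (u t') (k - 1) ξ

/-- The cube `Q_A = [-A/8, A/8]^d`. -/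
def cubeSet (d : ℕ) (A : ℝ) : Set (Edim d) := {ξ | ∀ i, |ξ i| ≤ A / 8}

/-- `Ω = ⋃_{η ∈ Σ} (η + Q_A)` with `Σ = {-2Ne₁, -Ne₁, Ne₁, 2Ne₁}`. -/
def OmegaSet (d : ℕ) (N A : ℝ) : Set (Edim d) :=
  {ξ | ∃ c : ℝ, (c = -2 * N ∨ c = -N ∨ c = N ∨ c = 2 * N) ∧
    ∀ i : Fin d, |ξ i - (if (i : ℕ) = 0 then c else 0)| ≤ A / 8}

/-- `Ω_k = ⋃_{η ∈ Σ_k} (η + Q_A)` with `Σ_k = {-Ne₁, Ne₁}` for even `k` and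
`Σ_k = {-2Ne₁, -Ne₁, Ne₁, 2Ne₁}` for odd `k`. -/
def OmegaKSet (d k : ℕ) (N A : ℝ) : Set (Edim d) :=
  {ξ | ∃ c : ℝ, (if k % 2 = 0 then c = -N ∨ c = N
      else c = -2 * N ∨ c = -N ∨ c = N ∨ c = 2 * N) ∧
    ∀ i : Fin d, |ξ i - (if (i : ℕ) = 0 then c else 0)| ≤ A / 8}

/-- `φ̂ = R·𝟙_Ω`. -/
def phiHat (d : ℕ) (N A R : ℝ) : Edim d → ℂ :=
  Set.indicator (OmegaSet d N A) fun _ => (R : ℂ)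

/-- `φ̂ = R·𝟙_{Ω_k}`. -/
def phiHatK (d k : ℕ) (N A R : ℝ) : Edim d → ℂ :=
  Set.indicator (OmegaKSet d k N A) fun _ => (R : ℂ)

/-- `g_s(A)`: `1` if `s < -d/2`; `(log⟨A⟩)^{1/2}` if `s = -d/2`; `A^{d/2+s}` if `s > -d/2`. -/
def gs (d : ℕ) (s A : ℝ) : ℝ :=
  if s < -(d : ℝ) / 2 then 1
  else if s = -(d : ℝ) / 2 then Real.sqrt (Real.log (Real.sqrt (1 + A ^ 2)))
  else A ^ ((d : ℝ) / 2 + s)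


section AlgConv

variable {d : ℕ} {B : Type*} [NormedCommRing B] [NormedAlgebra ℝ B]

/-- Convolution on `ℝ^d` of functions with values in a normed algebra. -/
def algConv (f g : Edim d → B) (ξ : Edim d) : B :=
  ∫ η, f (ξ - η) * g η

/-- `algConvIter f n` is the `(n+1)`-fold convolution `f ∗ ⋯ ∗ f`. -/
def algConvIter (f : Edim d → B) : ℕ → Edim d → B
  | 0 => f
  | n + 1 => algConv (algConvIter f n) f

lemma algConv_eq_convolution (f g : Edim d → B) :
    algConv f g = convolution g f (ContinuousLinearMap.mul ℝ B).flip volume := by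
  ext ξ
  simp [algConv, convolution, mul_comm]

lemma integrable_algConv_integrand {f g : Edim d → B} (hf : Integrable f) (hg : Integrable g) :
    Integrable (fun p : Edim d × Edim d => f (p.1 - p.2) * g p.2) (volume.prod volume) := by
  simpa [mul_comm] using hg.convolution_integrand (μ := volume) (ν := volume)
    (ContinuousLinearMap.mul ℝ B).flip hf

lemma ae_integrable_algConv {f g : Edim d → B} (hf : Integrable f) (hg : Integrable g) :
    ∀ᵐ ξ : Edim d, Integrable fun η => f (ξ - η) * g η :=
  (integrable_algConv_integrand hf hg).prod_right_ae

lemma integrable_algConv {f g : Edim d → B} (hf : Integrable f) (hg : Integrable g) :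
    Integrable (algConv f g) :=
  (integrable_algConv_integrand hf hg).integral_prod_left

lemma integral_norm_algConv_le {f g : Edim d → B} (hf : Integrable f) (hg : Integrable g) :
    ∫ ξ, ‖algConv f g ξ‖ ≤ (∫ ξ, ‖f ξ‖) * ∫ ξ, ‖g ξ‖ := by
  have h_integrable := integrable_algConv_integrand (B := ℝ) hf.norm hg.norm
  calc ∫ ξ, ‖algConv f g ξ‖
      ≤ ∫ ξ, algConv (fun ξ => ‖f ξ‖) (fun ξ => ‖g ξ‖) ξ := by
        refine integral_mono_ae (integrable_algConv hf hg).norm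
          (integrable_algConv (B := ℝ) hf.norm hg.norm) ?_
        filter_upwards [h_integrable.prod_right_ae] with ξ hξ
        exact norm_integral_le_of_norm_le hξ (Eventually.of_forall fun η => norm_mul_le _ _)
    _ = (∫ ξ, ‖f ξ‖) * ∫ ξ, ‖g ξ‖ := by
        rw [algConv_eq_convolution, integral_convolution _ hg.norm hf.norm]
        simp [mul_comm]

lemma integrable_algConvIter {f : Edim d → B} (hf : Integrable f) (n : ℕ) :
    Integrable (algConvIter f n) := by
  induction n with
  | zero => exact hf
  | succ n ih => exact integrable_algConv ih hf

lemma integral_norm_algConvIter_le {f : Edim d → B} (hf : Integrable f) {ρ : ℝ}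
    (hρ : ∫ ξ, ‖f ξ‖ ≤ ρ) (n : ℕ) :
    ∫ ξ, ‖algConvIter f n ξ‖ ≤ ρ ^ (n + 1) := by
  have h0 : 0 ≤ ∫ ξ, ‖f ξ‖ := integral_nonneg fun _ => norm_nonneg _
  induction n with
  | zero => simpa [algConvIter] using hρ
  | succ n ih =>
    calc _ ≤ _ := integral_norm_algConv_le (integrable_algConvIter hf n) hf
      _ ≤ ρ ^ (n + 1) * ρ := by
        have : 0 ≤ ρ := h0.trans hρ
        gcongr
      _ = _ := by ring

lemma algConv_sub_algConv_ae {f g f' g' : Edim d → B} (hf : Integrable f) (hg : Integrable g)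
    (hf' : Integrable f') (hg' : Integrable g') :
    ∀ᵐ ξ : Edim d, algConv f g ξ - algConv f' g' ξ =
      algConv (fun ξ => f ξ - f' ξ) g ξ + algConv f' (fun ξ => g ξ - g' ξ) ξ := by
  filter_upwards [ae_integrable_algConv hf hg, ae_integrable_algConv hf' hg',
    ae_integrable_algConv hf' hg] with ξ h1 h2 h3
  have e1 : algConv (fun ξ => f ξ - f' ξ) g ξ = algConv f g ξ - algConv f' g ξ := by
    simp only [algConv, sub_mul]
    exact integral_sub h1 h3
  have e2 : algConv f' (fun ξ => g ξ - g' ξ) ξ = algConv f' g ξ - algConv f' g' ξ := by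
    simp only [algConv, mul_sub]
    exact integral_sub h3 h2
  rw [e1, e2]
  abel

lemma integral_norm_algConvIter_sub_le {f g : Edim d → B} (hf : Integrable f) (hg : Integrable g)
    {ρ : ℝ} (hfρ : ∫ ξ, ‖f ξ‖ ≤ ρ) (hgρ : ∫ ξ, ‖g ξ‖ ≤ ρ) (n : ℕ) :
    ∫ ξ, ‖algConvIter f n ξ - algConvIter g n ξ‖ ≤ (n + 1) * ρ ^ n * ∫ ξ, ‖f ξ - g ξ‖ := by
  have h0 : 0 ≤ ∫ ξ, ‖f ξ‖ := integral_nonneg fun _ => norm_nonneg _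
  have hρ : 0 ≤ ρ := h0.trans hfρ
  have hfg : 0 ≤ ∫ ξ, ‖f ξ - g ξ‖ := integral_nonneg fun _ => norm_nonneg _
  induction n with
  | zero => simp [algConvIter]
  | succ n ih =>
    have hfn := integrable_algConvIter hf n
    have hgn := integrable_algConvIter hg n
    have i1 := integrable_algConv (hfn.sub hgn) hf
    have i2 := integrable_algConv hgn (hf.sub hg)
    calc ∫ ξ, ‖algConv (algConvIter f n) f ξ - algConv (algConvIter g n) g ξ‖
        ≤ ∫ ξ, (‖algConv (fun ξ => algConvIter f n ξ - algConvIter g n ξ) f ξ‖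
            + ‖algConv (algConvIter g n) (fun ξ => f ξ - g ξ) ξ‖) := by
          refine integral_mono_ae
            ((integrable_algConv hfn hf).sub (integrable_algConv hgn hg)).norm
            (i1.norm.add i2.norm) ?_
          filter_upwards [algConv_sub_algConv_ae hfn hf hgn hg] with ξ h
          rw [h]
          exact norm_add_le _ _
      _ = (∫ ξ, ‖algConv (fun ξ => algConvIter f n ξ - algConvIter g n ξ) f ξ‖)
            + ∫ ξ, ‖algConv (algConvIter g n) (fun ξ => f ξ - g ξ) ξ‖ :=
          integral_add i1.norm i2.norm
      _ ≤ ((n + 1) * ρ ^ n * ∫ ξ, ‖f ξ - g ξ‖) * ρ + ρ ^ (n + 1) * ∫ ξ, ‖f ξ - g ξ‖ := by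
          refine add_le_add ?_ ?_
          · refine (integral_norm_algConv_le (hfn.sub hgn) hf).trans ?_
            exact mul_le_mul ih hfρ h0 (by positivity)
          · refine (integral_norm_algConv_le hgn (hf.sub hg)).trans ?_
            exact mul_le_mul_of_nonneg_right (integral_norm_algConvIter_le hg hgρ n) hfg
      _ = _ := by push_cast; ring

end AlgConv

section RealConv

variable {d : ℕ}

lemma ae_sub_left {p : Edim d → Prop} (hp : ∀ᵐ ξ, p ξ) (ξ : Edim d) : ∀ᵐ η, p (ξ - η) :=
  (quasiMeasurePreserving_sub_left volume ξ).ae hp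

lemma algConv_mono_ae {f g f' g' : Edim d → ℝ} (hf : Integrable f) (hg : Integrable g)
    (hf' : Integrable f') (hg' : Integrable g') (hff' : ∀ᵐ ξ, 0 ≤ f ξ ∧ f ξ ≤ f' ξ)
    (hgg' : ∀ᵐ ξ, 0 ≤ g ξ ∧ g ξ ≤ g' ξ) :
    ∀ᵐ ξ, 0 ≤ algConv f g ξ ∧ algConv f g ξ ≤ algConv f' g' ξ := by
  filter_upwards [ae_integrable_algConv hf hg, ae_integrable_algConv hf' hg'] with ξ h1 h2
  have h3 := ae_sub_left hff' ξ
  constructor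
  · refine integral_nonneg_of_ae ?_
    filter_upwards [h3, hgg'] with η a b
    exact mul_nonneg a.1 b.1
  · refine integral_mono_ae h1 h2 ?_
    filter_upwards [h3, hgg'] with η a b
    exact mul_le_mul a.2 b.2 b.1 (a.1.trans a.2)

lemma algConvIter_mono_ae {f g : Edim d → ℝ} (hf : Integrable f) (hg : Integrable g)
    (hfg : ∀ ξ, 0 ≤ f ξ ∧ f ξ ≤ g ξ) (n : ℕ) :
    ∀ᵐ ξ, 0 ≤ algConvIter f n ξ ∧ algConvIter f n ξ ≤ algConvIter g n ξ := by
  induction n with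
  | zero => exact Eventually.of_forall hfg
  | succ n ih =>
    exact algConv_mono_ae (integrable_algConvIter hf n) hf (integrable_algConvIter hg n) hg ih
      (Eventually.of_forall hfg)

lemma integral_algConv {f g : Edim d → ℝ} (hf : Integrable f) (hg : Integrable g) :
    ∫ ξ, algConv f g ξ = (∫ ξ, f ξ) * ∫ ξ, g ξ := by
  rw [algConv_eq_convolution, integral_convolution _ hg hf]
  simp [mul_comm]

lemma integral_algConvIter {f : Edim d → ℝ} (hf : Integrable f) (n : ℕ) :
    ∫ ξ, algConvIter f n ξ = (∫ ξ, f ξ) ^ (n + 1) := by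
  induction n with
  | zero => simp [algConvIter]
  | succ n ih =>
    rw [algConvIter, integral_algConv (integrable_algConvIter hf n) hf, ih, ← pow_succ]

lemma norm_sub_le_of_algConv_ne_zero {f g : Edim d → ℝ} {x y : Edim d} {r r' : ℝ}
    (hf : ∀ ξ, f ξ ≠ 0 → ‖ξ - x‖ ≤ r) (hg : ∀ ξ, g ξ ≠ 0 → ‖ξ - y‖ ≤ r') (ξ : Edim d)
    (hξ : algConv f g ξ ≠ 0) : ‖ξ - (x + y)‖ ≤ r + r' := by
  contrapose! hξ
  refine integral_eq_zero_of_ae (Eventually.of_forall fun η => ?_)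
  by_contra hne
  obtain ⟨h1, h2⟩ := mul_ne_zero_iff.mp hne
  have h3 := norm_add_le (ξ - η - x) (η - y)
  rw [show ξ - η - x + (η - y) = ξ - (x + y) by abel] at h3
  linarith [hf _ h1, hg _ h2]

lemma norm_sub_le_of_algConvIter_ne_zero {f : Edim d → ℝ} {x : Edim d} {r : ℝ}
    (hf : ∀ ξ, f ξ ≠ 0 → ‖ξ - x‖ ≤ r) (n : ℕ) (ξ : Edim d)
    (hξ : algConvIter f n ξ ≠ 0) : ‖ξ - ((n : ℝ) + 1) • x‖ ≤ ((n : ℝ) + 1) * r := by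
  induction n generalizing ξ with
  | zero => simpa using hf ξ hξ
  | succ n ih =>
    have := norm_sub_le_of_algConv_ne_zero ih hf ξ hξ
    rw [show ((n : ℝ) + 1) • x + x = (((n + 1 : ℕ) : ℝ) + 1) • x by push_cast; module] at this
    push_cast at this ⊢
    linarith

/-- If `g` dominates two bumps whose centers satisfy `(j+1)x + y = 0`, then the `(j+2)`-fold
convolution power of `g` carries mass near the origin. -/
lemma le_setIntegral_algConvIter {f₁ f₂ g : Edim d → ℝ} (h₁ : Integrable f₁) (h₂ : Integrable f₂)
    (hg : Integrable g) (h₁g : ∀ ξ, 0 ≤ f₁ ξ ∧ f₁ ξ ≤ g ξ) (h₂g : ∀ ξ, 0 ≤ f₂ ξ ∧ f₂ ξ ≤ g ξ)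
    {x y : Edim d} {r : ℝ} (hx : ∀ ξ, f₁ ξ ≠ 0 → ‖ξ - x‖ ≤ r) (hy : ∀ ξ, f₂ ξ ≠ 0 → ‖ξ - y‖ ≤ r)
    (j : ℕ) (hxy : ((j : ℝ) + 1) • x + y = 0) :
    (∫ ξ, f₁ ξ) ^ (j + 1) * ∫ ξ, f₂ ξ ≤
      ∫ ξ in Metric.closedBall 0 (((j : ℝ) + 2) * r), algConvIter g (j + 1) ξ := by
  have i₁ := integrable_algConvIter h₁ j
  have ig := integrable_algConvIter hg (j + 1)
  rw [← integral_algConvIter h₁, ← integral_algConv i₁ h₂,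
    ← setIntegral_eq_integral_of_forall_compl_eq_zero
      (s := Metric.closedBall 0 (((j : ℝ) + 2) * r))]
  · refine setIntegral_mono_ae (integrable_algConv i₁ h₂).integrableOn ig.integrableOn ?_
    filter_upwards [algConv_mono_ae i₁ h₂ (integrable_algConvIter hg j) hg
      (algConvIter_mono_ae h₁ hg h₁g j) (Eventually.of_forall h₂g)] with ξ h
    exact h.2
  · intro ξ hξ
    by_contra hne
    have := norm_sub_le_of_algConv_ne_zero (norm_sub_le_of_algConvIter_ne_zero hx j) hy ξ hne
    rw [hxy, sub_zero] at this
    refine hξ (mem_closedBall_zero_iff.mpr (this.trans_eq (by ring)))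

lemma convIter_ofReal (f : Edim d → ℝ) (n : ℕ) (ξ : Edim d) :
    convIter d (fun ξ => (f ξ : ℂ)) n ξ = ((algConvIter f n ξ : ℝ) : ℂ) := by
  induction n generalizing ξ with
  | zero => rfl
  | succ n ih =>
    simp only [convIter, algConvIter, conv, algConv, ih]
    rw [← integral_complex_ofReal]
    simp

lemma ae_algConvIter_apply {K : Type*} [TopologicalSpace K] [CompactSpace K]
    {U : Edim d → C(K, ℂ)} (hU : Integrable U) (n : ℕ) :
    ∀ᵐ ξ, ∀ t, algConvIter U n ξ t = convIter d (fun ξ => U ξ t) n ξ := by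
  induction n with
  | zero => exact Eventually.of_forall fun ξ t => rfl
  | succ n ih =>
    filter_upwards [ae_integrable_algConv (integrable_algConvIter hU n) hU] with ξ hξ t
    rw [algConvIter, algConv, ContinuousMap.integral_apply hξ]
    refine integral_congr_ae ?_
    filter_upwards [ae_sub_left ih ξ] with η hη
    simp [hη t]

end RealConv

section Symbols

/-- The continuous extension of `Wsym` to `r = 0`. -/
def Wcont (t r : ℝ) : ℝ := Real.exp (-(r * t) / 2) * (t * Real.sinc (Real.sqrt 3 / 2 * r * t))

lemma Wsym_eq_Wcont (t : ℝ) {r : ℝ} (hr : r ≠ 0) : Wsym t r = Wcont t r := by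
  have h3 : Real.sqrt 3 ≠ 0 := by positivity
  rcases eq_or_ne t 0 with rfl | ht
  · simp [Wsym, V1sym, Wcont]
  · have : Real.sqrt 3 / 2 * r * t ≠ 0 := by positivity
    rw [Wsym, V1sym, Wcont, Psym, Real.sinc_of_ne_zero this]
    field_simp

lemma continuous_Wcont : Continuous fun p : ℝ × ℝ => Wcont p.1 p.2 := by
  have := Real.continuous_sinc
  unfold Wcont
  fun_prop

lemma abs_Wcont_le {t r : ℝ} (ht : 0 ≤ t) (hr : 0 ≤ r) : |Wcont t r| ≤ t := by
  rw [Wcont, abs_mul, abs_mul, abs_of_nonneg ht, Real.abs_exp]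
  have h1 : Real.exp (-(r * t) / 2) ≤ 1 := by
    rw [Real.exp_le_one_iff]
    have := mul_nonneg hr ht
    linarith
  have h2 := Real.abs_sinc_le_one (Real.sqrt 3 / 2 * r * t)
  calc _ ≤ 1 * (t * 1) := by gcongr
    _ = t := by ring

lemma three_quarters_le_exp {x : ℝ} (hx : x ≤ 1 / 2) : 3 / 4 ≤ Real.exp (-x / 2) := by
  have := Real.add_one_le_exp (-x / 2)
  linarith

lemma sqrt_three_div_two_mem : 0 ≤ Real.sqrt 3 / 2 ∧ Real.sqrt 3 / 2 ≤ 1 := by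
  refine ⟨by positivity, ?_⟩
  have : Real.sqrt 3 ≤ 2 := by
    rw [Real.sqrt_le_left (by norm_num)]
    norm_num
  linarith

lemma half_le_Wcont {t r : ℝ} (ht : 0 ≤ t) (hr : 0 ≤ r) (hrt : r * t ≤ 1 / 2) :
    t / 2 ≤ Wcont t r := by
  have h0 : 0 ≤ r * t := mul_nonneg hr ht
  have h1 := three_quarters_le_exp hrt
  obtain ⟨ha, hb⟩ := sqrt_three_div_two_mem
  set x := Real.sqrt 3 / 2 * r * t with hx
  have hx0 : 0 ≤ x := by positivity
  have hx1 : x ≤ 1 / 2 := by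
    rw [hx, mul_assoc]
    nlinarith
  have h2 : 3 / 4 ≤ Real.sinc x := by
    rcases hx0.eq_or_lt with h | h
    · rw [← h]; norm_num
    · rw [Real.sinc_of_ne_zero h.ne', le_div_iff₀ h]
      have := Real.sin_gt_sub_cube h
      have : x ^ 3 ≤ x * (1 / 4) := by
        rw [pow_succ' x 2]
        gcongr
        nlinarith
      linarith
  rw [Wcont, ← hx]
  calc t / 2 ≤ 3 / 4 * (t * (3 / 4)) := by linarith
    _ ≤ _ := by gcongr

/-- Symbol of `P(t)V₀(t)`. -/
def PV0 (t r : ℝ) : ℝ := Psym t r * V0sym t r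

lemma continuous_PV0 : Continuous fun p : ℝ × ℝ => PV0 p.1 p.2 := by
  unfold PV0 Psym V0sym
  fun_prop

lemma abs_PV0_le {t r : ℝ} (ht : 0 ≤ t) (hr : 0 ≤ r) : |PV0 t r| ≤ 2 := by
  have h1 : Real.exp (-(r * t) / 2) ≤ 1 := by
    rw [Real.exp_le_one_iff]
    have := mul_nonneg hr ht
    linarith
  have h3 : 1 / Real.sqrt 3 ≤ 1 := by
    rw [div_le_one (by positivity), Real.one_le_sqrt]
    norm_num
  rw [PV0, Psym, V0sym, abs_mul, Real.abs_exp]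
  have h2 : |Real.cos (Real.sqrt 3 / 2 * r * t) +
      1 / Real.sqrt 3 * Real.sin (Real.sqrt 3 / 2 * r * t)| ≤ 2 := by
    refine (abs_add_le _ _).trans ?_
    rw [abs_mul, abs_of_nonneg (show 0 ≤ 1 / Real.sqrt 3 by positivity)]
    have := Real.abs_cos_le_one (Real.sqrt 3 / 2 * r * t)
    have := mul_le_mul h3 (Real.abs_sin_le_one (Real.sqrt 3 / 2 * r * t)) (abs_nonneg _) zero_le_one
    linarith
  exact (mul_le_mul h1 h2 (abs_nonneg _) zero_le_one).trans_eq (by norm_num)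

lemma half_le_PV0 {t r : ℝ} (ht : 0 ≤ t) (hr : 0 ≤ r) (hrt : r * t ≤ 1 / 2) :
    1 / 2 ≤ PV0 t r := by
  have h0 : 0 ≤ r * t := mul_nonneg hr ht
  have h1 := three_quarters_le_exp hrt
  obtain ⟨ha, hb⟩ := sqrt_three_div_two_mem
  have hx0 : 0 ≤ Real.sqrt 3 / 2 * r * t := by positivity
  have hx1 : Real.sqrt 3 / 2 * r * t ≤ 1 / 2 := by
    rw [mul_assoc]
    nlinarith
  have h2 := Real.one_sub_sq_div_two_le_cos (x := Real.sqrt 3 / 2 * r * t)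
  have h3 := Real.sin_nonneg_of_nonneg_of_le_pi hx0 (by linarith [Real.pi_gt_three])
  have h4 : 3 / 4 ≤ V0sym t r := by
    have : 0 ≤ 1 / Real.sqrt 3 * Real.sin (Real.sqrt 3 / 2 * r * t) := by positivity
    rw [V0sym]
    nlinarith
  rw [PV0, Psym]
  calc (1 : ℝ) / 2 ≤ 3 / 4 * (3 / 4) := by norm_num
    _ ≤ _ := by gcongr

end Symbols

section DuhamelOperator

variable {d : ℕ} {T : ℝ}

lemma continuous_duhamel_integral (hT : 0 ≤ T) :
    Continuous fun p : (Edim d × C(Icc (0 : ℝ) T, ℂ)) × Icc (0 : ℝ) T =>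
      ∫ t' in (0 : ℝ)..p.2, ((Wcont (p.2 - t') ‖p.1.1‖ : ℝ) : ℂ) * p.1.2 (projIcc 0 T hT t') := by
  refine intervalIntegral.continuous_parametric_intervalIntegral_of_continuous ?_ (by fun_prop)
  have h1 := continuous_Wcont
  have h2 : Continuous fun q : ((Edim d × C(Icc (0 : ℝ) T, ℂ)) × Icc (0 : ℝ) T) × ℝ =>
      Wcont (q.1.2 - q.2) ‖q.1.1.1‖ :=
    h1.comp (f := fun q : ((Edim d × C(Icc (0 : ℝ) T, ℂ)) × Icc (0 : ℝ) T) × ℝ =>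
      ((q.1.2 : ℝ) - q.2, ‖q.1.1.1‖)) (by fun_prop)
  have h3 : Continuous fun q : ((Edim d × C(Icc (0 : ℝ) T, ℂ)) × Icc (0 : ℝ) T) × ℝ =>
      q.1.1.2 (projIcc 0 T hT q.2) :=
    Continuous.eval (by fun_prop) (continuous_projIcc.comp continuous_snd)
  exact (Complex.continuous_ofReal.comp h2).mul h3

/-- The Duhamel integral at a fixed frequency, as a map on continuous functions of time. -/
def duhamelOp (hT : 0 ≤ T) (ξ : Edim d) (v : C(Icc (0 : ℝ) T, ℂ)) : C(Icc (0 : ℝ) T, ℂ) where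
  toFun t := ∫ t' in (0 : ℝ)..t, ((Wcont (t - t') ‖ξ‖ : ℝ) : ℂ) * v (projIcc 0 T hT t')
  continuous_toFun := (continuous_duhamel_integral hT).comp (Continuous.prodMk_right (ξ, v))

lemma continuous_duhamelOp (hT : 0 ≤ T) :
    Continuous fun p : Edim d × C(Icc (0 : ℝ) T, ℂ) => duhamelOp hT p.1 p.2 :=
  ContinuousMap.continuous_of_continuous_uncurry _ (continuous_duhamel_integral hT)

lemma continuous_duhamel_integrand (hT : 0 ≤ T) (ξ : Edim d) (v : C(Icc (0 : ℝ) T, ℂ)) (t : ℝ) :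
    Continuous fun t' => ((Wcont (t - t') ‖ξ‖ : ℝ) : ℂ) * v (projIcc 0 T hT t') := by
  have h2 : Continuous fun t' => Wcont (t - t') ‖ξ‖ :=
    continuous_Wcont.comp (f := fun t' : ℝ => (t - t', ‖ξ‖)) (by fun_prop)
  exact (Complex.continuous_ofReal.comp h2).mul (v.continuous.comp continuous_projIcc)

lemma norm_duhamelOp_le (hT : 0 ≤ T) (ξ : Edim d) (v : C(Icc (0 : ℝ) T, ℂ)) :
    ‖duhamelOp hT ξ v‖ ≤ T ^ 2 * ‖v‖ := by
  refine (ContinuousMap.norm_le _ (by positivity)).mpr fun t => ?_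
  have ht := t.2
  have : ‖duhamelOp hT ξ v t‖ ≤ (T * ‖v‖) * |(t : ℝ) - 0| := by
    refine intervalIntegral.norm_integral_le_of_norm_le_const fun t' ht' => ?_
    rw [uIoc_of_le ht.1] at ht'
    rw [norm_mul, Complex.norm_real, Real.norm_eq_abs]
    have h1 := abs_Wcont_le (t := t - t') (r := ‖ξ‖) (by linarith [ht'.2]) (norm_nonneg _)
    exact mul_le_mul (by linarith [ht'.1, ht.2]) (v.norm_coe_le_norm _) (norm_nonneg _) hT
  refine this.trans ?_
  rw [sub_zero, abs_of_nonneg ht.1]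
  calc T * ‖v‖ * t ≤ T * ‖v‖ * T := by gcongr; exact ht.2
    _ = _ := by ring

lemma duhamelOp_sub (hT : 0 ≤ T) (ξ : Edim d) (v w : C(Icc (0 : ℝ) T, ℂ)) :
    duhamelOp hT ξ v - duhamelOp hT ξ w = duhamelOp hT ξ (v - w) := by
  ext t
  simp only [duhamelOp, ContinuousMap.sub_apply, ContinuousMap.coe_mk, mul_sub]
  rw [intervalIntegral.integral_sub]
  · exact (continuous_duhamel_integrand hT ξ v t).intervalIntegrable _ _
  · exact (continuous_duhamel_integrand hT ξ w t).intervalIntegrable _ _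

lemma aestronglyMeasurable_comp_curried {Y Z : Type*} [TopologicalSpace Y] [TopologicalSpace Z]
    {g : Edim d → Y → Z} (hg : Continuous fun p : Edim d × Y => g p.1 p.2) {v : Edim d → Y}
    (hv : AEStronglyMeasurable v volume) : AEStronglyMeasurable (fun ξ => g ξ (v ξ)) volume :=
  hg.comp_aestronglyMeasurable (continuous_id.aestronglyMeasurable.prodMk hv)

lemma integrable_duhamelOp (hT : 0 ≤ T) {v : Edim d → C(Icc (0 : ℝ) T, ℂ)} (hv : Integrable v) :
    Integrable fun ξ => duhamelOp hT ξ (v ξ) := by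
  have hmeas : AEStronglyMeasurable (fun ξ => duhamelOp hT ξ (v ξ)) volume :=
    aestronglyMeasurable_comp_curried (continuous_duhamelOp hT) hv.aestronglyMeasurable
  exact (hv.norm.const_mul (T ^ 2)).mono' hmeas
    (Eventually.of_forall fun ξ => norm_duhamelOp_le hT ξ (v ξ))

lemma integral_norm_duhamelOp_le (hT : 0 ≤ T) {v : Edim d → C(Icc (0 : ℝ) T, ℂ)}
    (hv : Integrable v) :
    ∫ ξ, ‖duhamelOp hT ξ (v ξ)‖ ≤ T ^ 2 * ∫ ξ, ‖v ξ‖ := by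
  rw [← integral_const_mul]
  exact integral_mono (integrable_duhamelOp hT hv).norm (hv.norm.const_mul _)
    fun ξ => norm_duhamelOp_le hT ξ (v ξ)

lemma integral_norm_duhamelOp_algConvIter_sub_le (hT : 0 ≤ T)
    {v w : Edim d → C(Icc (0 : ℝ) T, ℂ)} (hv : Integrable v) (hw : Integrable w) {ρ : ℝ}
    (hvρ : ∫ ξ, ‖v ξ‖ ≤ ρ) (hwρ : ∫ ξ, ‖w ξ‖ ≤ ρ) (n : ℕ) :
    ∫ ξ, ‖duhamelOp hT ξ (algConvIter v n ξ) - duhamelOp hT ξ (algConvIter w n ξ)‖ ≤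
      T ^ 2 * ((n + 1) * ρ ^ n) * ∫ ξ, ‖v ξ - w ξ‖ := by
  simp only [duhamelOp_sub]
  refine (integral_norm_duhamelOp_le hT
    ((integrable_algConvIter hv n).sub (integrable_algConvIter hw n))).trans ?_
  rw [mul_assoc]
  exact mul_le_mul_of_nonneg_left (integral_norm_algConvIter_sub_le hv hw hvρ hwρ n) (sq_nonneg T)

/-- Solution of the Duhamel equation by the contraction principle in `L¹(ℝ^d; C([0,T]))`. -/
lemma exists_duhamel_fixedPoint (hT : 0 ≤ T) {h : Edim d → C(Icc (0 : ℝ) T, ℂ)}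
    (hh : Integrable h) {ρ : ℝ} (hρ : 0 ≤ ρ) (hhρ : ∫ ξ, ‖h ξ‖ ≤ ρ / 2) (n : ℕ)
    (hsmall : T ^ 2 * ((n + 1) * ρ ^ n) ≤ 1 / 2) :
    ∃ U : Edim d → C(Icc (0 : ℝ) T, ℂ), StronglyMeasurable U ∧ Integrable U ∧
      ∫ ξ, ‖U ξ‖ ≤ ρ ∧ ∀ᵐ ξ, U ξ = h ξ - duhamelOp hT ξ (algConvIter U n ξ) := by
  have h_integrable : ∀ u : Lp C(Icc (0 : ℝ) T, ℂ) 1 (volume : Measure (Edim d)), Integrable u :=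
    fun u => L1.integrable_coeFn u
  have hΦ : ∀ u : Lp C(Icc (0 : ℝ) T, ℂ) 1 (volume : Measure (Edim d)),
      Integrable fun ξ => h ξ - duhamelOp hT ξ (algConvIter u n ξ) := fun u =>
    hh.sub (integrable_duhamelOp hT (integrable_algConvIter (h_integrable u) n))
  let Φ : Lp C(Icc (0 : ℝ) T, ℂ) 1 (volume : Measure (Edim d)) →
      Lp C(Icc (0 : ℝ) T, ℂ) 1 (volume : Measure (Edim d)) := fun u => (hΦ u).toL1 _
  let s : Set (Lp C(Icc (0 : ℝ) T, ℂ) 1 (volume : Measure (Edim d))) := Metric.closedBall 0 ρ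
  have hmem : ∀ u ∈ s, ∫ ξ, ‖u ξ‖ ≤ ρ := fun u hu => by
    rw [← L1.norm_eq_integral_norm]
    exact mem_closedBall_zero_iff.mp hu
  have hmaps : MapsTo Φ s s := by
    intro u hu
    have hi := integrable_algConvIter (h_integrable u) n
    refine mem_closedBall_zero_iff.mpr ?_
    rw [L1.norm_eq_integral_norm]
    calc ∫ ξ, ‖Φ u ξ‖ = ∫ ξ, ‖h ξ - duhamelOp hT ξ (algConvIter u n ξ)‖ := by
          refine integral_congr_ae ?_
          filter_upwards [(hΦ u).coeFn_toL1] with ξ hξ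
          rw [hξ]
      _ ≤ ∫ ξ, (‖h ξ‖ + ‖duhamelOp hT ξ (algConvIter u n ξ)‖) :=
          integral_mono (hΦ u).norm (hh.norm.add (integrable_duhamelOp hT hi).norm)
            fun ξ => norm_sub_le _ _
      _ = (∫ ξ, ‖h ξ‖) + ∫ ξ, ‖duhamelOp hT ξ (algConvIter u n ξ)‖ :=
          integral_add hh.norm (integrable_duhamelOp hT hi).norm
      _ ≤ ρ / 2 + T ^ 2 * ρ ^ (n + 1) := by
          refine add_le_add hhρ ((integral_norm_duhamelOp_le hT hi).trans ?_)
          exact mul_le_mul_of_nonneg_left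
            (integral_norm_algConvIter_le (h_integrable u) (hmem u hu) n) (sq_nonneg T)
      _ ≤ ρ := by
          have h1 : T ^ 2 * ρ ^ n ≤ T ^ 2 * ((n + 1) * ρ ^ n) := by
            have : 0 ≤ (n : ℝ) * ρ ^ n := by positivity
            refine mul_le_mul_of_nonneg_left ?_ (sq_nonneg T)
            linarith
          have := mul_le_mul_of_nonneg_right (h1.trans hsmall) hρ
          rw [pow_succ ρ n]
          linarith
  have hcontr : ContractingWith (1 / 2) (hmaps.restrict Φ s s) := by
    refine ⟨by norm_num, LipschitzWith.of_dist_le_mul fun u v => ?_⟩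
    have hu := hmem _ u.2
    have hv := hmem _ v.2
    rw [Subtype.dist_eq, Subtype.dist_eq, dist_eq_norm, dist_eq_norm, L1.norm_eq_integral_norm,
      L1.norm_eq_integral_norm]
    have e1 : ∫ ξ, ‖((u : Lp C(Icc (0 : ℝ) T, ℂ) 1 (volume : Measure (Edim d))) - v :
        Lp C(Icc (0 : ℝ) T, ℂ) 1 (volume : Measure (Edim d))) ξ‖ = ∫ ξ, ‖u.1 ξ - v.1 ξ‖ := by
      refine integral_congr_ae ?_
      filter_upwards [Lp.coeFn_sub u.1 v.1] with ξ hξ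
      rw [hξ, Pi.sub_apply]
    have e2 : ∫ ξ, ‖(Φ u.1 - Φ v.1) ξ‖ =
        ∫ ξ, ‖duhamelOp hT ξ (algConvIter u.1 n ξ) - duhamelOp hT ξ (algConvIter v.1 n ξ)‖ := by
      refine integral_congr_ae ?_
      filter_upwards [Lp.coeFn_sub (Φ u.1) (Φ v.1), (hΦ u.1).coeFn_toL1, (hΦ v.1).coeFn_toL1]
        with ξ h1 h2 h3
      rw [h1, Pi.sub_apply, h2, h3, sub_sub_sub_cancel_left, norm_sub_rev]
    change ∫ ξ, ‖(Φ u.1 - Φ v.1) ξ‖ ≤ _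
    rw [e1, e2]
    refine (integral_norm_duhamelOp_algConvIter_sub_le hT (h_integrable u.1) (h_integrable v.1)
      hu hv n).trans ?_
    have h0 : 0 ≤ ∫ ξ, ‖u.1 ξ - v.1 ξ‖ := integral_nonneg fun _ => norm_nonneg _
    simpa using mul_le_mul_of_nonneg_right hsmall h0
  obtain ⟨U, hUs, hfix, -⟩ := hcontr.exists_fixedPoint' Metric.isClosed_closedBall.isComplete hmaps
    (x := 0) (Metric.mem_closedBall_self hρ) (edist_ne_top _ _)
  refine ⟨U, Lp.stronglyMeasurable U, h_integrable U, hmem U hUs, ?_⟩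
  filter_upwards [(hΦ U).coeFn_toL1] with ξ hξ
  rw [← hξ]
  exact congrArg (fun V : Lp C(Icc (0 : ℝ) T, ℂ) 1 (volume : Measure (Edim d)) => V ξ) hfix.symm

end DuhamelOperator

section LinearFlow

variable {d : ℕ} {T : ℝ}

lemma continuous_linear_flow :
    Continuous fun p : (Edim d × (ℂ × ℂ)) × Icc (0 : ℝ) T =>
      ((PV0 p.2 ‖p.1.1‖ : ℝ) : ℂ) * p.1.2.1 + ((Wcont p.2 ‖p.1.1‖ : ℝ) : ℂ) * p.1.2.2 := by
  have h : Continuous fun p : (Edim d × (ℂ × ℂ)) × Icc (0 : ℝ) T => ((p.2 : ℝ), ‖p.1.1‖) := by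
    fun_prop
  have h1 := Complex.continuous_ofReal.comp (continuous_PV0.comp h)
  have h2 := Complex.continuous_ofReal.comp (continuous_Wcont.comp h)
  exact (h1.mul (by fun_prop)).add (h2.mul (by fun_prop))

/-- The linear flow at a fixed frequency, as a continuous function of time. -/
def linearFlow (T : ℝ) (ξ : Edim d) (z : ℂ × ℂ) : C(Icc (0 : ℝ) T, ℂ) where
  toFun t := ((PV0 t ‖ξ‖ : ℝ) : ℂ) * z.1 + ((Wcont t ‖ξ‖ : ℝ) : ℂ) * z.2
  continuous_toFun := by
    have h : Continuous fun t : Icc (0 : ℝ) T => ((t : ℝ), ‖ξ‖) := by fun_prop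
    have h1 := Complex.continuous_ofReal.comp (continuous_PV0.comp h)
    have h2 := Complex.continuous_ofReal.comp (continuous_Wcont.comp h)
    exact (h1.mul continuous_const).add (h2.mul continuous_const)

lemma continuous_linearFlow :
    Continuous fun p : Edim d × (ℂ × ℂ) => linearFlow T p.1 p.2 :=
  ContinuousMap.continuous_of_continuous_uncurry _ continuous_linear_flow

lemma norm_linearFlow_le (hT : T ≤ 1) (ξ : Edim d) (z : ℂ × ℂ) :
    ‖linearFlow T ξ z‖ ≤ 2 * ‖z.1‖ + ‖z.2‖ := by
  refine (ContinuousMap.norm_le _ (by positivity)).mpr fun t => ?_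
  refine (norm_add_le _ _).trans ?_
  rw [norm_mul, norm_mul, Complex.norm_real, Complex.norm_real, Real.norm_eq_abs, Real.norm_eq_abs]
  have h1 := abs_PV0_le t.2.1 (norm_nonneg ξ)
  have h2 := (abs_Wcont_le t.2.1 (norm_nonneg ξ)).trans (t.2.2.trans hT)
  have h3 := mul_le_mul_of_nonneg_right h1 (norm_nonneg z.1)
  have h4 := mul_le_mul_of_nonneg_right h2 (norm_nonneg z.2)
  linarith

lemma linearFlow_add (ξ : Edim d) (z w : ℂ × ℂ) :
    linearFlow T ξ (z + w) = linearFlow T ξ z + linearFlow T ξ w := by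
  ext t
  simp only [linearFlow, ContinuousMap.coe_mk, ContinuousMap.add_apply, Prod.fst_add, Prod.snd_add]
  ring

lemma integrable_linearFlow (hT : T ≤ 1) {F₀ F₁ : Edim d → ℂ} (h₀ : Integrable F₀)
    (h₁ : Integrable F₁) : Integrable fun ξ => linearFlow T ξ (F₀ ξ, F₁ ξ) := by
  have hmeas : AEStronglyMeasurable (fun ξ => linearFlow T ξ (F₀ ξ, F₁ ξ)) volume :=
    aestronglyMeasurable_comp_curried continuous_linearFlow
      (h₀.aestronglyMeasurable.prodMk h₁.aestronglyMeasurable)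
  exact ((h₀.norm.const_mul 2).add h₁.norm).mono' hmeas
    (Eventually.of_forall fun ξ => norm_linearFlow_le hT ξ _)

lemma integral_norm_linearFlow_le (hT : T ≤ 1) {F₀ F₁ : Edim d → ℂ} (h₀ : Integrable F₀)
    (h₁ : Integrable F₁) :
    ∫ ξ, ‖linearFlow T ξ (F₀ ξ, F₁ ξ)‖ ≤ 2 * (∫ ξ, ‖F₀ ξ‖) + ∫ ξ, ‖F₁ ξ‖ := by
  rw [← integral_const_mul, ← integral_add (h₀.norm.const_mul 2) h₁.norm]
  exact integral_mono (integrable_linearFlow hT h₀ h₁).norm ((h₀.norm.const_mul 2).add h₁.norm)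
    fun ξ => norm_linearFlow_le hT ξ _

lemma FLNorm_eq_ofReal {F : Edim d → ℂ} (hF : Integrable F) :
    FLNorm d F = ENNReal.ofReal (∫ ξ, ‖F ξ‖) :=
  (ofReal_integral_norm_eq_lintegral_enorm hF).symm

lemma integrable_apply {U : Edim d → C(Icc (0 : ℝ) T, ℂ)} (hU : Integrable U) (t : Icc (0 : ℝ) T) :
    Integrable fun ξ => U ξ t :=
  hU.norm.mono' ((continuous_eval_const t).comp_aestronglyMeasurable
    hU.aestronglyMeasurable) (Eventually.of_forall fun ξ => (U ξ).norm_coe_le_norm t)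

lemma isDuhamelSolution_of_fixedPoint (hd : 1 ≤ d) (hT : 0 ≤ T) {n : ℕ} {F₀ F₁ : Edim d → ℂ}
    {U : Edim d → C(Icc (0 : ℝ) T, ℂ)} (hUm : StronglyMeasurable U) (hU : Integrable U)
    (hfix : ∀ᵐ ξ, U ξ = linearFlow T ξ (F₀ ξ, F₁ ξ) - duhamelOp hT ξ (algConvIter U n ξ)) :
    IsDuhamelSolution d (n + 1) T F₀ F₁ fun t ξ => U ξ (projIcc 0 T hT t) where
  measurable t _ :=
    ((continuous_eval_const (projIcc 0 T hT t)).comp_stronglyMeasurable hUm).measurable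
  finite t _ := by
    rw [FLNorm_eq_ofReal (integrable_apply hU _)]
    exact ENNReal.ofReal_lt_top
  continuous t₀ _ ε hε := by
    have hcont : Continuous fun t : ℝ =>
        ∫ ξ, ‖U ξ (projIcc 0 T hT t) - U ξ (projIcc 0 T hT t₀)‖ := by
      refine continuous_of_dominated (bound := fun ξ => ‖U ξ‖ + ‖U ξ‖) ?_ ?_
        (hU.norm.add hU.norm) ?_
      · exact fun t =>
          ((integrable_apply hU _).sub (integrable_apply hU _)).norm.aestronglyMeasurable
      · refine fun t => Eventually.of_forall fun ξ => ?_
        rw [norm_norm]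
        exact (norm_sub_le _ _).trans
          (add_le_add ((U ξ).norm_coe_le_norm _) ((U ξ).norm_coe_le_norm _))
      · exact Eventually.of_forall fun ξ =>
          (((U ξ).continuous.comp continuous_projIcc).sub continuous_const).norm
    obtain ⟨δ, hδ, h⟩ := Metric.continuous_iff.mp hcont t₀ ε hε
    refine ⟨δ, hδ, fun t _ hlt => ?_⟩
    have := h t (by rwa [Real.dist_eq])
    have e := FLNorm_eq_ofReal (F := fun ξ => U ξ (projIcc 0 T hT t) - U ξ (projIcc 0 T hT t₀))
      ((integrable_apply hU _).sub (integrable_apply hU _))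
    rw [e, ENNReal.ofReal_lt_ofReal_iff hε]
    refine (le_abs_self _).trans_lt ?_
    simpa [Real.dist_eq] using this
  duhamel t ht := by
    have : Nonempty (Fin d) := ⟨⟨0, hd⟩⟩
    have hne : ∀ᵐ ξ : Edim d, ξ ≠ 0 := compl_mem_ae_iff.mpr (measure_singleton 0)
    filter_upwards [hfix, hne, ae_algConvIter_apply hU n] with ξ h1 h2 h3
    have hr : ‖ξ‖ ≠ 0 := norm_ne_zero_iff.mpr h2
    have hW : ∀ t, Wsym t ‖ξ‖ = Wcont t ‖ξ‖ := fun t => Wsym_eq_Wcont t hr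
    have hW' : Psym t ‖ξ‖ * V1sym t ‖ξ‖ = Wcont t ‖ξ‖ := hW t
    rw [hW']
    simp only [hW]
    conv_lhs => rw [h1]
    simp only [linearFlow, duhamelOp, ContinuousMap.sub_apply, ContinuousMap.coe_mk, h3,
      projIcc_of_mem hT ht, PV0, Nat.add_sub_cancel]

end LinearFlow

section LowerBound

variable {d : ℕ} {T : ℝ}

lemma linearFlow_ofReal_apply (φ : Edim d → ℝ) (ξ : Edim d) (t : Icc (0 : ℝ) T) :
    linearFlow T ξ ((φ ξ : ℂ), 0) t = ((PV0 t ‖ξ‖ * φ ξ : ℝ) : ℂ) := by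
  simp [linearFlow]

lemma integrable_linearFlow_ofReal (hT : T ≤ 1) {φ : Edim d → ℝ} (hφ : Integrable φ) :
    Integrable fun ξ => linearFlow T ξ ((φ ξ : ℂ), 0) :=
  integrable_linearFlow hT hφ.ofReal (integrable_zero _ _ _)

lemma integrable_PV0_mul (hT : T ≤ 1) {φ : Edim d → ℝ} (hφ : Integrable φ) (t : Icc (0 : ℝ) T) :
    Integrable fun ξ => PV0 t ‖ξ‖ * φ ξ := by
  have h := integrable_apply (integrable_linearFlow_ofReal hT hφ) t
  have e : (fun ξ => PV0 t ‖ξ‖ * φ ξ) =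
      fun ξ => (linearFlow T ξ ((φ ξ : ℂ), 0) t).re := by
    ext ξ
    rw [linearFlow_ofReal_apply, Complex.ofReal_re]
  rw [e]
  exact h.re

/-- The low-frequency nonlinear interaction of the linear evolution of nonnegative data is
positive. -/
lemma ae_le_re_algConvIter_linearFlow (hT : 0 ≤ T) (hT1 : T ≤ 1) {φ : Edim d → ℝ}
    (hφ : Integrable φ) (h0 : ∀ ξ, 0 ≤ φ ξ) (hsupp : ∀ ξ, φ ξ ≠ 0 → ‖ξ‖ * T ≤ 1 / 2) (n : ℕ) :
    ∀ᵐ ξ, ∀ t, algConvIter (fun ξ => φ ξ / 2) n ξ ≤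
      (algConvIter (fun ξ => linearFlow T ξ ((φ ξ : ℂ), 0)) n ξ t).re ∧
      0 ≤ algConvIter (fun ξ => φ ξ / 2) n ξ := by
  have : Nonempty (Icc (0 : ℝ) T) := ⟨⟨0, le_rfl, hT⟩⟩
  have hprof : ∀ t : Icc (0 : ℝ) T, ∀ ξ, 0 ≤ φ ξ / 2 ∧ φ ξ / 2 ≤ PV0 t ‖ξ‖ * φ ξ := by
    intro t ξ
    refine ⟨by linarith [h0 ξ], ?_⟩
    by_cases h : φ ξ = 0
    · simp [h]
    · have h1 : ‖ξ‖ * t ≤ 1 / 2 :=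
        (mul_le_mul_of_nonneg_left t.2.2 (norm_nonneg ξ)).trans (hsupp ξ h)
      have := mul_le_mul_of_nonneg_right (half_le_PV0 t.2.1 (norm_nonneg ξ) h1) (h0 ξ)
      linarith
  have hmono : ∀ᵐ ξ, ∀ i, 0 ≤ algConvIter (fun ξ => φ ξ / 2) n ξ ∧
      algConvIter (fun ξ => φ ξ / 2) n ξ ≤
        algConvIter (fun ξ => PV0 (TopologicalSpace.denseSeq (Icc (0 : ℝ) T) i) ‖ξ‖ * φ ξ) n ξ :=
    ae_all_iff.mpr fun i =>
      algConvIter_mono_ae (hφ.div_const 2) (integrable_PV0_mul hT1 hφ _) (hprof _) n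
  filter_upwards [hmono, ae_algConvIter_apply
    (integrable_linearFlow_ofReal hT1 hφ) n] with ξ h1 h2 t
  refine ⟨?_, (h1 0).1⟩
  refine (TopologicalSpace.denseRange_denseSeq (Icc (0 : ℝ) T)).induction_on
    (p := fun t => algConvIter (fun ξ => φ ξ / 2) n ξ ≤
      (algConvIter (fun ξ => linearFlow T ξ ((φ ξ : ℂ), 0)) n ξ t).re) t ?_ fun i => ?_
  · exact isClosed_le continuous_const (Complex.continuous_re.comp (ContinuousMap.continuous _))
  · have h3 := h2 (TopologicalSpace.denseSeq (Icc (0 : ℝ) T) i)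
    simp only [linearFlow_ofReal_apply] at h3
    rw [convIter_ofReal] at h3
    change _ ≤ (algConvIter (fun ξ => linearFlow T ξ ((φ ξ : ℂ), 0)) n ξ _).re
    rw [h3, Complex.ofReal_re]
    exact (h1 i).2

lemma le_norm_duhamelOp_apply (hT : 0 ≤ T) {ξ : Edim d} (hξ : ‖ξ‖ * T ≤ 1 / 2)
    {v : C(Icc (0 : ℝ) T, ℂ)} {m : ℝ} (hm : 0 ≤ m) (hv : ∀ t, m ≤ (v t).re) :
    T ^ 2 / 4 * m ≤ ‖duhamelOp hT ξ v ⟨T, right_mem_Icc.mpr hT⟩‖ := by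
  refine le_trans ?_ (Complex.re_le_norm _)
  have hc := continuous_duhamel_integrand hT ξ v T
  have e : (duhamelOp hT ξ v ⟨T, right_mem_Icc.mpr hT⟩).re =
      ∫ t' in (0 : ℝ)..T, (((Wcont (T - t') ‖ξ‖ : ℝ) : ℂ) * v (projIcc 0 T hT t')).re := by
    change (∫ t' in (0 : ℝ)..T, ((Wcont (T - t') ‖ξ‖ : ℝ) : ℂ) * v (projIcc 0 T hT t')).re = _
    exact (Complex.reCLM.intervalIntegral_comp_comm (hc.intervalIntegrable 0 T)).symm
  have e2 : ∫ t' in (0 : ℝ)..T, (T - t') / 2 * m = T ^ 2 / 4 * m := by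
    rw [intervalIntegral.integral_mul_const, intervalIntegral.integral_div,
      intervalIntegral.integral_sub intervalIntegrable_const intervalIntegral.intervalIntegrable_id,
      intervalIntegral.integral_const, integral_id, smul_eq_mul]
    ring
  rw [e, ← e2]
  refine intervalIntegral.integral_mono_on hT ?_ ?_ fun t' ht' => ?_
  · exact Continuous.intervalIntegrable (by fun_prop) _ _
  · exact (Complex.continuous_re.comp hc).intervalIntegrable _ _
  · rw [Complex.re_ofReal_mul]
    have h0 : 0 ≤ T - t' := sub_nonneg.mpr ht'.2
    have h1 : ‖ξ‖ * (T - t') ≤ 1 / 2 :=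
      (mul_le_mul_of_nonneg_left (by linarith [ht'.1]) (norm_nonneg ξ)).trans hξ
    have h2 := half_le_Wcont h0 (norm_nonneg ξ) h1
    exact mul_le_mul h2 (hv _) hm (by linarith)

end LowerBound

section Perturbation

variable {d : ℕ} {T : ℝ}

/-- The solution with data `(F₀ + φ, F₁)` at low frequency is bounded below by the nonlinear
self-interaction of `φ`, up to errors controlled by the size of `(F₀, F₁)`. -/
lemma le_setIntegral_norm_solution (hT : 0 ≤ T) (hT1 : T ≤ 1) {n : ℕ} {F₀ F₁ : Edim d → ℂ}
    (h₀ : Integrable F₀) (h₁ : Integrable F₁) {φ : Edim d → ℝ} (hφ : Integrable φ)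
    (hφ0 : ∀ ξ, 0 ≤ φ ξ) (hsupp : ∀ ξ, φ ξ ≠ 0 → ‖ξ‖ * T ≤ 1 / 2)
    {U : Edim d → C(Icc (0 : ℝ) T, ℂ)} (hU : Integrable U)
    (hfix : ∀ᵐ ξ, U ξ = linearFlow T ξ (F₀ ξ + φ ξ, F₁ ξ) - duhamelOp hT ξ (algConvIter U n ξ))
    {ρ C r : ℝ} (hUρ : ∫ ξ, ‖U ξ‖ ≤ ρ)
    (hφρ : ∫ ξ, ‖linearFlow T ξ ((φ ξ : ℂ), 0)‖ ≤ ρ)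
    (hC : 2 * (∫ ξ, ‖F₀ ξ‖) + ∫ ξ, ‖F₁ ξ‖ ≤ C) (hr : ∀ ξ, ‖ξ‖ ≤ r → φ ξ = 0)
    (hrT : r * T ≤ 1 / 2) :
    T ^ 2 / 4 * ∫ ξ in Metric.closedBall 0 r, algConvIter (fun ξ => φ ξ / 2) n ξ ≤
      (∫ ξ in Metric.closedBall 0 r, ‖U ξ ⟨T, right_mem_Icc.mpr hT⟩‖) + C +
        T ^ 2 * ((n + 1) * ρ ^ n) * (C + T ^ 2 * ρ ^ (n + 1)) := by
  set L : Edim d → C(Icc (0 : ℝ) T, ℂ) := fun ξ => linearFlow T ξ (F₀ ξ, F₁ ξ) with hL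
  set P : Edim d → C(Icc (0 : ℝ) T, ℂ) := fun ξ => linearFlow T ξ ((φ ξ : ℂ), 0) with hP
  set D : Edim d → C(Icc (0 : ℝ) T, ℂ) := fun ξ =>
    duhamelOp hT ξ (algConvIter U n ξ) - duhamelOp hT ξ (algConvIter P n ξ) with hD
  have hρ : 0 ≤ ρ := (integral_nonneg fun _ => norm_nonneg _).trans hUρ
  have iL : Integrable L := integrable_linearFlow hT1 h₀ h₁
  have iP : Integrable P := integrable_linearFlow_ofReal hT1 hφ
  have iU := integrable_duhamelOp hT (integrable_algConvIter hU n)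
  have iD : Integrable D := iU.sub (integrable_duhamelOp hT (integrable_algConvIter iP n))
  have hLC : ∫ ξ, ‖L ξ‖ ≤ C := (integral_norm_linearFlow_le hT1 h₀ h₁).trans hC
  have hsplit : ∀ᵐ ξ, U ξ = L ξ + P ξ - duhamelOp hT ξ (algConvIter U n ξ) := by
    filter_upwards [hfix] with ξ h
    rw [h, hL, hP]
    dsimp only
    rw [← linearFlow_add, Prod.mk_add_mk, add_zero]
  have hUP : ∫ ξ, ‖U ξ - P ξ‖ ≤ C + T ^ 2 * ρ ^ (n + 1) := by
    have h1 : ∫ ξ, ‖U ξ - P ξ‖ ≤ ∫ ξ, (‖L ξ‖ + ‖duhamelOp hT ξ (algConvIter U n ξ)‖) := by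
      refine integral_mono_ae (hU.sub iP).norm (iL.norm.add iU.norm) ?_
      filter_upwards [hsplit] with ξ h
      have e : U ξ - P ξ = L ξ - duhamelOp hT ξ (algConvIter U n ξ) := by
        rw [sub_eq_iff_eq_add]
        exact h.trans (by abel)
      rw [e]
      exact norm_sub_le _ _
    rw [integral_add iL.norm iU.norm] at h1
    refine h1.trans (add_le_add hLC ((integral_norm_duhamelOp_le hT
      (integrable_algConvIter hU n)).trans ?_))
    exact mul_le_mul_of_nonneg_left (integral_norm_algConvIter_le hU hUρ n) (sq_nonneg T)
  have hDle : ∫ ξ, ‖D ξ‖ ≤ T ^ 2 * ((n + 1) * ρ ^ n) * (C + T ^ 2 * ρ ^ (n + 1)) :=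
    (integral_norm_duhamelOp_algConvIter_sub_le hT hU iP hUρ hφρ n).trans
      (mul_le_mul_of_nonneg_left hUP (by positivity))
  have hlow : ∀ᵐ ξ, ξ ∈ Metric.closedBall (0 : Edim d) r →
      T ^ 2 / 4 * algConvIter (fun ξ => φ ξ / 2) n ξ ≤
        ‖U ξ ⟨T, right_mem_Icc.mpr hT⟩‖ + ‖L ξ‖ + ‖D ξ‖ := by
    filter_upwards [hsplit, ae_le_re_algConvIter_linearFlow hT hT1 hφ hφ0 hsupp n] with ξ h1 h2 hξ
    have hξr : ‖ξ‖ ≤ r := mem_closedBall_zero_iff.mp hξ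
    have hξT : ‖ξ‖ * T ≤ 1 / 2 := (mul_le_mul_of_nonneg_right hξr hT).trans hrT
    refine (le_norm_duhamelOp_apply hT hξT (h2 ⟨0, le_rfl, hT⟩).2 fun t => (h2 t).1).trans ?_
    have hP0 : P ξ = 0 := by
      ext t
      simp [hP, linearFlow, hr ξ hξr]
    have e : duhamelOp hT ξ (algConvIter P n ξ) = L ξ - U ξ - D ξ := by
      rw [hP0, add_zero] at h1
      simp only [hD]
      nth_rw 1 [h1]
      abel
    change ‖duhamelOp hT ξ (algConvIter P n ξ) _‖ ≤ _
    rw [e, ContinuousMap.sub_apply, ContinuousMap.sub_apply]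
    have b1 := norm_sub_le (L ξ ⟨T, right_mem_Icc.mpr hT⟩ - U ξ ⟨T, right_mem_Icc.mpr hT⟩)
      (D ξ ⟨T, right_mem_Icc.mpr hT⟩)
    have b2 := norm_sub_le (L ξ ⟨T, right_mem_Icc.mpr hT⟩) (U ξ ⟨T, right_mem_Icc.mpr hT⟩)
    have b3 := (L ξ).norm_coe_le_norm ⟨T, right_mem_Icc.mpr hT⟩
    have b4 := (D ξ).norm_coe_le_norm ⟨T, right_mem_Icc.mpr hT⟩
    linarith
  have iUT := (integrable_apply hU ⟨T, right_mem_Icc.mpr hT⟩).norm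
  calc T ^ 2 / 4 * ∫ ξ in Metric.closedBall 0 r, algConvIter (fun ξ => φ ξ / 2) n ξ
      = ∫ ξ in Metric.closedBall 0 r, T ^ 2 / 4 * algConvIter (fun ξ => φ ξ / 2) n ξ :=
        (integral_const_mul _ _).symm
    _ ≤ ∫ ξ in Metric.closedBall 0 r, (‖U ξ ⟨T, right_mem_Icc.mpr hT⟩‖ + ‖L ξ‖ + ‖D ξ‖) := by
        refine setIntegral_mono_on_ae ?_ ?_ measurableSet_closedBall hlow
        · exact ((integrable_algConvIter (hφ.div_const 2) n).const_mul _).integrableOn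
        · exact ((iUT.add iL.norm).add iD.norm).integrableOn
    _ = (∫ ξ in Metric.closedBall 0 r, ‖U ξ ⟨T, right_mem_Icc.mpr hT⟩‖) +
          (∫ ξ in Metric.closedBall 0 r, ‖L ξ‖) + ∫ ξ in Metric.closedBall 0 r, ‖D ξ‖ := by
        have iUL : Integrable fun ξ => ‖U ξ ⟨T, right_mem_Icc.mpr hT⟩‖ + ‖L ξ‖ := iUT.add iL.norm
        rw [integral_add iUL.integrableOn iD.norm.integrableOn,
          integral_add iUT.integrableOn iL.norm.integrableOn]
    _ ≤ _ := by
        have c1 := setIntegral_le_integral (s := Metric.closedBall (0 : Edim d) r) iL.norm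
          (Eventually.of_forall fun _ => norm_nonneg _)
        have c2 := setIntegral_le_integral (s := Metric.closedBall (0 : Edim d) r) iD.norm
          (Eventually.of_forall fun _ => norm_nonneg _)
        linarith

end Perturbation

section Bump

variable {d : ℕ}

/-- The multiple of the indicator function of a ball whose integral is `M`. -/
def bump (x : Edim d) (A M : ℝ) : Edim d → ℝ :=
  (Metric.closedBall x A).indicator fun _ => M / volume.real (Metric.closedBall x A)

lemma bump_nonneg {x : Edim d} {A M : ℝ} (hM : 0 ≤ M) (ξ : Edim d) : 0 ≤ bump x A M ξ :=
  indicator_nonneg (fun _ _ => div_nonneg hM measureReal_nonneg) ξ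

lemma norm_sub_le_of_bump_ne_zero {x : Edim d} {A M : ℝ} (ξ : Edim d) (h : bump x A M ξ ≠ 0) :
    ‖ξ - x‖ ≤ A := by
  by_contra hξ
  exact h (indicator_of_notMem (fun h' => hξ (mem_closedBall_iff_norm.mp h')) _)

lemma measurable_bump (x : Edim d) (A M : ℝ) : Measurable (bump x A M) :=
  measurable_const.indicator measurableSet_closedBall

lemma integrable_bump (x : Edim d) (A M : ℝ) : Integrable (bump x A M) :=
  (integrableOn_const (measure_closedBall_lt_top.ne)).integrable_indicator measurableSet_closedBall

lemma measureReal_closedBall_pos (x : Edim d) {A : ℝ} (hA : 0 < A) :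
    0 < volume.real (Metric.closedBall x A) :=
  ENNReal.toReal_pos (Metric.measure_closedBall_pos volume x hA).ne' measure_closedBall_lt_top.ne

lemma integral_bump (x : Edim d) {A : ℝ} (hA : 0 < A) (M : ℝ) : ∫ ξ, bump x A M ξ = M := by
  have := measureReal_closedBall_pos x hA
  rw [bump, integral_indicator measurableSet_closedBall, setIntegral_const, smul_eq_mul]
  field_simp

lemma integral_bump_sq (x : Edim d) {A : ℝ} (hA : 0 < A) (M : ℝ) :
    Integrable (fun ξ => bump x A M ξ ^ 2) ∧
      ∫ ξ, bump x A M ξ ^ 2 = M ^ 2 / volume.real (Metric.closedBall x A) := by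
  have := measureReal_closedBall_pos x hA
  have e : (fun ξ => bump x A M ξ ^ 2) = (Metric.closedBall x A).indicator
      fun _ => (M / volume.real (Metric.closedBall x A)) ^ 2 := by
    ext ξ
    by_cases h : ξ ∈ Metric.closedBall x A <;> simp [bump, h]
  rw [e]
  refine ⟨(integrableOn_const (measure_closedBall_lt_top.ne)).integrable_indicator
    measurableSet_closedBall, ?_⟩
  rw [integral_indicator measurableSet_closedBall, setIntegral_const, smul_eq_mul]
  field_simp

lemma measureReal_closedBall_eq (x : Edim d) {A : ℝ} (hA : 0 ≤ A) :
    volume.real (Metric.closedBall x A) =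
      A ^ d * volume.real (Metric.closedBall (0 : Edim d) 1) := by
  rw [Measure.addHaar_real_closedBall' _ _ hA, finrank_euclideanSpace, Fintype.card_fin]

lemma HsNormSq_bump_add_bump_le {s : ℝ} (hs : s ≤ 0) {x y : Edim d} {A r : ℝ} (hA : 0 < A)
    (hr : 0 < r) (hx : r + A ≤ ‖x‖) (hy : r + A ≤ ‖y‖) (M : ℝ) :
    HsNormSq d s (fun ξ => ((bump x A M ξ + bump y A M ξ : ℝ) : ℂ)) ≤
      ENNReal.ofReal (r ^ (2 * s) *
        (4 * M ^ 2 / (A ^ d * volume.real (Metric.closedBall (0 : Edim d) 1)))) := by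
  obtain ⟨ix, ex⟩ := integral_bump_sq x hA M
  obtain ⟨iy, ey⟩ := integral_bump_sq y hA M
  rw [measureReal_closedBall_eq _ hA.le] at ex ey
  have e : r ^ (2 * s) * (4 * M ^ 2 / (A ^ d * volume.real (Metric.closedBall (0 : Edim d) 1))) =
      ∫ ξ, r ^ (2 * s) * (2 * (bump x A M ξ ^ 2 + bump y A M ξ ^ 2)) := by
    rw [integral_const_mul, integral_const_mul, integral_add ix iy, ex, ey]
    ring
  have ixy : Integrable fun ξ => r ^ (2 * s) * (2 * (bump x A M ξ ^ 2 + bump y A M ξ ^ 2)) :=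
    ((ix.add iy).const_mul 2).const_mul _
  rw [e, ofReal_integral_eq_lintegral_ofReal ixy (Eventually.of_forall fun ξ => by positivity)]
  refine lintegral_mono fun ξ => ENNReal.ofReal_le_ofReal ?_
  rw [Complex.norm_real, Real.norm_eq_abs, sq_abs]
  by_cases h : bump x A M ξ = 0 ∧ bump y A M ξ = 0
  · simp [h.1, h.2]
  · have hξ : r ≤ ‖ξ‖ := by
      rcases not_and_or.mp h with h | h
      · have h1 := norm_sub_le_of_bump_ne_zero ξ h
        have h2 := norm_sub_norm_le x ξ
        rw [norm_sub_rev] at h2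
        linarith
      · have h1 := norm_sub_le_of_bump_ne_zero ξ h
        have h2 := norm_sub_norm_le y ξ
        rw [norm_sub_rev] at h2
        linarith
    have h1 : (1 + ‖ξ‖ ^ 2) ^ s ≤ r ^ (2 * s) := by
      have h2 : r ^ 2 ≤ 1 + ‖ξ‖ ^ 2 := by nlinarith
      rw [Real.rpow_mul hr.le, Real.rpow_two]
      exact Real.rpow_le_rpow_of_nonpos (by positivity) h2 hs
    refine mul_le_mul h1 ?_ (sq_nonneg _) (by positivity)
    nlinarith [sq_nonneg (bump x A M ξ - bump y A M ξ)]

end Bump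

section SobolevLowerBound

variable {d : ℕ}

lemma ofReal_integral_le_lintegral_ofReal {α : Type*} [MeasurableSpace α] {μ : Measure α}
    {f : α → ℝ} (hf : Integrable f μ) :
    ENNReal.ofReal (∫ x, f x ∂μ) ≤ ∫⁻ x, ENNReal.ofReal (f x) ∂μ := by
  rw [integral_eq_lintegral_pos_part_sub_lintegral_neg_part hf]
  exact (ENNReal.ofReal_le_ofReal (sub_le_self _ ENNReal.toReal_nonneg)).trans
    ENNReal.ofReal_toReal_le

/-- The `H^s` norm for `s ≤ 0` controls the `L¹` norm of the Fourier transform on balls. -/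
lemma le_HsNormSq {s : ℝ} (hs : s ≤ 0) {r : ℝ} (hr : 1 ≤ r) {F : Edim d → ℂ} (hF : Integrable F) :
    ENNReal.ofReal ((2 * r ^ 2) ^ s * ((∫ ξ in Metric.closedBall 0 r, ‖F ξ‖) ^ 2 /
      (r ^ d * volume.real (Metric.closedBall (0 : Edim d) 1)))) ≤ HsNormSq d s F := by
  have hr0 : 0 < r := by linarith
  have hV := measureReal_closedBall_pos (0 : Edim d) hr0
  rw [← measureReal_closedBall_eq (0 : Edim d) hr0.le]
  set V := volume.real (Metric.closedBall (0 : Edim d) r)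
  set I := ∫ ξ in Metric.closedBall 0 r, ‖F ξ‖
  set B := Metric.closedBall (0 : Edim d) r
  have hc : IntegrableOn (fun _ : Edim d => (I / V) ^ 2) B :=
    integrableOn_const measure_closedBall_lt_top.ne
  have hi : IntegrableOn (fun ξ => 2 * (I / V) * ‖F ξ‖) B :=
    (hF.norm.const_mul (2 * (I / V))).integrableOn
  have e : (2 * r ^ 2) ^ s * (I ^ 2 / V) =
      ∫ ξ in B, (2 * r ^ 2) ^ s * (2 * (I / V) * ‖F ξ‖ - (I / V) ^ 2) := by
    rw [integral_const_mul, integral_sub hi hc, integral_const_mul, setIntegral_const, smul_eq_mul]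
    change _ = _ * (2 * (I / V) * I - V * (I / V) ^ 2)
    field_simp
    ring
  calc _ ≤ ∫⁻ ξ in B, ENNReal.ofReal ((2 * r ^ 2) ^ s * (2 * (I / V) * ‖F ξ‖ - (I / V) ^ 2)) := by
        rw [e]
        exact ofReal_integral_le_lintegral_ofReal ((hi.sub hc).const_mul _)
    _ ≤ ∫⁻ ξ in B, ENNReal.ofReal ((1 + ‖ξ‖ ^ 2) ^ s * ‖F ξ‖ ^ 2) := by
        refine setLIntegral_mono' measurableSet_closedBall fun ξ hξ => ENNReal.ofReal_le_ofReal ?_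
        have hξr : ‖ξ‖ ≤ r := mem_closedBall_zero_iff.mp hξ
        have h1 : (2 * r ^ 2) ^ s ≤ (1 + ‖ξ‖ ^ 2) ^ s := by
          refine Real.rpow_le_rpow_of_nonpos (by positivity) ?_ hs
          nlinarith [norm_nonneg ξ]
        have h2 : 2 * (I / V) * ‖F ξ‖ - (I / V) ^ 2 ≤ ‖F ξ‖ ^ 2 := by
          nlinarith [sq_nonneg (‖F ξ‖ - I / V)]
        calc _ ≤ (2 * r ^ 2) ^ s * ‖F ξ‖ ^ 2 := by gcongr
          _ ≤ _ := by gcongr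
    _ ≤ _ := setLIntegral_le_lintegral _ _

end SobolevLowerBound

section Inflation

variable {d : ℕ}

/-- Data `(F₀ + φ, F₁)`, with `φ` a sum of two bumps at frequencies `N • e` and
`-(j + 1) N • e`, produce a large low-frequency part at time `c / N`. -/
lemma exists_solution_large_low_frequency (hd : 1 ≤ d) (j : ℕ) {F₀ F₁ : Edim d → ℂ}
    (h₀ : Integrable F₀) (h₁ : Integrable F₁) {c C N M A : ℝ} (hc : 0 < c)
    (hcj : c * (j + 3) ≤ 1 / 2) (hc2 : c ^ 2 * ((j + 2) * 10 ^ (j + 1)) ≤ 1 / 2)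
    (hC : 2 * (∫ ξ, ‖F₀ ξ‖) + ∫ ξ, ‖F₁ ξ‖ ≤ C) (hA : 0 < A) (hN1 : 1 ≤ N)
    (hNA : (j + 4) * A ≤ N) (hMN : M ^ (j + 1) = N ^ 2) (hMC : C ≤ M)
    {e : Edim d} (he : ‖e‖ = 1) {φ : Edim d → ℝ}
    (hφ : φ = fun ξ => bump (N • e) A M ξ + bump (-((j + 1) * N) • e) A M ξ) :
    ∃ u : ℝ → Edim d → ℂ, IsDuhamelSolution d (j + 2) (c / N) (fun ξ => F₀ ξ + φ ξ) F₁ u ∧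
      Integrable (u (c / N)) ∧
      c ^ 2 / 4 * (M / 2 ^ (j + 2)) ≤
        (∫ ξ in Metric.closedBall 0 ((j + 2) * A), ‖u (c / N) ξ‖) + C +
          c ^ 2 * ((j + 2) * 10 ^ (j + 1)) * (C + c ^ 2 * (10 ^ (j + 2) * M)) := by
  have hN : 0 < N := by linarith
  have hjA : 0 ≤ (j : ℝ) * A := by positivity
  have hjN : 0 ≤ (j : ℝ) * N := by positivity
  have hjc : 0 ≤ c * j := by positivity
  have hT : 0 ≤ c / N := by positivity
  have hT1 : c / N ≤ 1 := (div_le_one hN).mpr (by nlinarith)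
  have hC0 : 0 ≤ C := le_trans (add_nonneg (mul_nonneg zero_le_two
    (integral_nonneg fun _ => norm_nonneg _)) (integral_nonneg fun _ => norm_nonneg _)) hC
  have hM : 0 ≤ M := hC0.trans hMC
  have hTM : (c / N) ^ 2 * M ^ (j + 1) = c ^ 2 := by
    rw [hMN]
    field_simp
  have ix := integrable_bump (N • e) A M
  have iy := integrable_bump (-((j + 1) * N) • e) A M
  have iφ : Integrable φ := by rw [hφ]; exact ix.add iy
  have hφ0 : ∀ ξ, 0 ≤ φ ξ := fun ξ => by
    rw [hφ]
    exact add_nonneg (bump_nonneg hM ξ) (bump_nonneg hM ξ)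
  have hφint : ∫ ξ, φ ξ = 2 * M := by
    rw [hφ, integral_add ix iy, integral_bump _ hA, integral_bump _ hA]
    ring
  have nx : ‖N • e‖ = N := by rw [norm_smul, he, mul_one, Real.norm_of_nonneg hN.le]
  have ny : ‖-((j + 1) * N) • e‖ = (j + 1) * N := by
    rw [norm_smul, he, mul_one, norm_neg, Real.norm_of_nonneg (by positivity)]
  have hloc : ∀ ξ, φ ξ ≠ 0 → N - A ≤ ‖ξ‖ ∧ ‖ξ‖ ≤ (j + 1) * N + A := by
    intro ξ hξ
    have : bump (N • e) A M ξ ≠ 0 ∨ bump (-((j + 1) * N) • e) A M ξ ≠ 0 := by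
      by_contra! h
      exact hξ (by rw [hφ]; simp only [h.1, h.2, add_zero])
    rcases this with h | h
    · have h1 := norm_sub_le_of_bump_ne_zero ξ h
      have h2 := abs_le.mp ((abs_norm_sub_norm_le ξ (N • e)).trans h1)
      rw [nx] at h2
      constructor <;> linarith
    · have h1 := norm_sub_le_of_bump_ne_zero ξ h
      have h2 := abs_le.mp ((abs_norm_sub_norm_le ξ (-((j + 1) * N) • e)).trans h1)
      rw [ny] at h2
      constructor <;> linarith
  have hfreq : ∀ R, R ≤ (j + 3) * N → R * (c / N) ≤ 1 / 2 := by
    intro R hR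
    calc R * (c / N) ≤ ((j + 3) * N) * (c / N) := by gcongr
      _ = c * (j + 3) := by field_simp
      _ ≤ 1 / 2 := hcj
  have hsupp : ∀ ξ, φ ξ ≠ 0 → ‖ξ‖ * (c / N) ≤ 1 / 2 := fun ξ hξ =>
    hfreq _ (by linarith [(hloc ξ hξ).2])
  have hlow : ∀ ξ, ‖ξ‖ ≤ (j + 2) * A → φ ξ = 0 := by
    intro ξ hξ
    by_contra h
    linarith [(hloc ξ h).1]
  have iG : Integrable fun ξ => F₀ ξ + φ ξ := h₀.add iφ.ofReal
  have iφnorm : ∫ ξ, ‖(φ ξ : ℂ)‖ = 2 * M := by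
    rw [← hφint]
    exact integral_congr_ae (Eventually.of_forall fun ξ => by
      simp only [Complex.norm_real, Real.norm_of_nonneg (hφ0 ξ)])
  have hφρ : ∫ ξ, ‖linearFlow (c / N) ξ ((φ ξ : ℂ), 0)‖ ≤ 10 * M := by
    have := integral_norm_linearFlow_le hT1 (F₀ := fun ξ => (φ ξ : ℂ)) (F₁ := fun _ => 0)
      iφ.ofReal (integrable_zero _ _ _)
    simp only [norm_zero, integral_zero, iφnorm] at this
    linarith
  have hhρ : ∫ ξ, ‖linearFlow (c / N) ξ (F₀ ξ + φ ξ, F₁ ξ)‖ ≤ 10 * M / 2 := by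
    have h1 := integral_norm_linearFlow_le hT1 iG h₁
    have h2 : ∫ ξ, ‖F₀ ξ + φ ξ‖ ≤ (∫ ξ, ‖F₀ ξ‖) + ∫ ξ, ‖(φ ξ : ℂ)‖ := by
      rw [← integral_add h₀.norm iφ.ofReal.norm]
      exact integral_mono iG.norm (h₀.norm.add iφ.ofReal.norm) fun ξ => norm_add_le _ _
    linarith
  have hpow : (c / N) ^ 2 * (((j + 1 : ℕ) + 1) * (10 * M) ^ (j + 1)) =
      c ^ 2 * ((j + 2) * 10 ^ (j + 1)) := by
    rw [← hTM, mul_pow]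
    push_cast
    ring
  have hpow2 : (c / N) ^ 2 * (10 * M) ^ (j + 1 + 1) = c ^ 2 * (10 ^ (j + 2) * M) := by
    rw [← hTM, mul_pow]
    ring
  obtain ⟨U, hUm, hU, hUρ, hfix⟩ := exists_duhamel_fixedPoint hT
    (integrable_linearFlow hT1 iG h₁) (by positivity) hhρ (j + 1) (hpow.trans_le hc2)
  refine ⟨_, isDuhamelSolution_of_fixedPoint hd hT hUm hU hfix, integrable_apply hU _, ?_⟩
  have key := le_setIntegral_norm_solution hT hT1 h₀ h₁ iφ hφ0 hsupp hU hfix hUρ hφρ hC hlow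
    (hfreq _ (by linarith))
  rw [hpow, hpow2] at key
  rw [projIcc_right]
  refine le_trans ?_ key
  have hmain := le_setIntegral_algConvIter (ix.div_const 2) (iy.div_const 2) (iφ.div_const 2)
    (fun ξ => ⟨div_nonneg (bump_nonneg hM ξ) zero_le_two, by
      have := bump_nonneg (x := -((j + 1) * N) • e) (A := A) hM ξ
      simp only [hφ]
      linarith⟩)
    (fun ξ => ⟨div_nonneg (bump_nonneg hM ξ) zero_le_two, by
      have := bump_nonneg (x := N • e) (A := A) hM ξ
      simp only [hφ]
      linarith⟩)
    (x := N • e) (y := -((j + 1) * N) • e) (r := A)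
    (fun ξ h => norm_sub_le_of_bump_ne_zero ξ (left_ne_zero_of_mul h))
    (fun ξ h => norm_sub_le_of_bump_ne_zero ξ (left_ne_zero_of_mul h)) j
    (by rw [smul_smul, ← add_smul, add_neg_cancel, zero_smul])
  rw [integral_div, integral_div, integral_bump _ hA, integral_bump _ hA] at hmain
  refine le_trans (le_of_eq ?_) (mul_le_mul_of_nonneg_left hmain (by positivity))
  rw [← hTM, ← pow_succ, div_pow M]
  ring

end Inflation

section Parameters

lemma exists_scaling_exponent {d q s : ℝ} (hd : 0 < d) (hq : 0 < q) (hs : s < 0)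
    (hsq : s < d / 2 - q) :
    ∃ α : ℝ, 0 < α ∧ 0 < 1 - α ∧ 0 < 2 * q + α * (2 * s) - α * d ∧
      0 < -(2 * s + 2 * q - α * d) := by
  have hds : 0 < d - 2 * s := by linarith
  have h1 : 0 < 2 * q / (d - 2 * s) := by positivity
  have h2 : 2 * (q + s) / d < 2 * q / (d - 2 * s) := by
    rw [div_lt_div_iff₀ hd hds]
    nlinarith
  obtain ⟨α, hα, hα'⟩ := exists_between (max_lt h1 h2)
  obtain ⟨h3, h4⟩ := max_lt_iff.mp hα
  rw [lt_div_iff₀ hds] at hα'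
  rw [div_lt_iff₀ hd] at h4
  refine ⟨α, h3, ?_, by linarith, by linarith⟩
  by_contra! h
  nlinarith

lemma exists_parameters {d n : ℕ} (hd : 1 ≤ d) (hn : 1 ≤ n) {s : ℝ} (hs : s < 0)
    (hsn : s < (d : ℝ) / 2 - 2 / n) {K : ℝ} (hK : 0 < K) :
    ∃ N M A : ℝ, 1 ≤ A ∧ K ≤ M ∧ K * A ≤ N ∧ M ^ n = N ^ 2 ∧
      K ≤ M ^ 2 * A ^ (2 * s) / A ^ d ∧ N ^ (2 * s) * M ^ 2 / A ^ d ≤ 1 / K := by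
  have hd' : (0 : ℝ) < d := by exact_mod_cast hd
  have hn' : (0 : ℝ) < n := by exact_mod_cast hn
  have hq : (0 : ℝ) < 2 / n := by positivity
  obtain ⟨α, h1, h2, h3, h4⟩ := exists_scaling_exponent hd' hq hs hsn
  obtain ⟨x, hx1, hxq, hx2, hx3, hx4⟩ := ((eventually_ge_atTop (1 : ℝ)).and
    (((tendsto_rpow_atTop hq).eventually_ge_atTop K).and
    (((tendsto_rpow_atTop h2).eventually_ge_atTop K).and
    (((tendsto_rpow_atTop h3).eventually_ge_atTop K).and
    ((tendsto_rpow_atTop h4).eventually_ge_atTop K))))).exists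
  have hx : 0 < x := by linarith
  refine ⟨x, x ^ (2 / n : ℝ), x ^ α, Real.one_le_rpow hx1 h1.le, hxq, ?_, ?_, ?_, ?_⟩
  · calc K * x ^ α ≤ x ^ (1 - α) * x ^ α := by gcongr
      _ = x := by rw [← Real.rpow_add hx, sub_add_cancel, Real.rpow_one]
  · rw [← Real.rpow_mul_natCast hx.le, div_mul_cancel₀ _ hn'.ne', Real.rpow_two]
  · rw [Real.rpow_sub hx, Real.rpow_add hx] at hx3
    rw [← Real.rpow_mul_natCast hx.le, ← Real.rpow_mul_natCast hx.le, ← Real.rpow_mul hx.le,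
      mul_comm _ ((2 : ℕ) : ℝ)]
    exact_mod_cast hx3
  · rw [Real.rpow_neg hx.le, Real.rpow_sub hx, Real.rpow_add hx] at hx4
    rw [← Real.rpow_mul_natCast hx.le, ← Real.rpow_mul_natCast hx.le, mul_comm _ ((2 : ℕ) : ℝ),
      one_div]
    refine le_inv_of_le_inv₀ hK ?_
    exact_mod_cast hx4

lemma exists_small_time_constant (j : ℕ) :
    ∃ c : ℝ, 0 < c ∧ c ≤ 1 ∧ c * (j + 3) ≤ 1 / 2 ∧
      c ^ 2 * ((j + 2) * 10 ^ (j + 1)) ≤ 1 / 2 ∧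
      c ^ 2 * ((j + 2) * 10 ^ (j + 1)) * 10 ^ (j + 2) ≤ 1 / (8 * 2 ^ (j + 2)) := by
  have hlim : ∀ a : ℝ, Tendsto (fun c : ℝ => c ^ 2 * a) (𝓝[>] 0) (𝓝 0) := fun a => by
    have : Continuous fun c : ℝ => c ^ 2 * a := by fun_prop
    simpa using (this.tendsto 0).mono_left nhdsWithin_le_nhds
  have hlin : Tendsto (fun c : ℝ => c * (j + 3)) (𝓝[>] 0) (𝓝 0) := by
    have : Continuous fun c : ℝ => c * (j + 3) := by fun_prop
    simpa using (this.tendsto 0).mono_left nhdsWithin_le_nhds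
  have hpos : ∀ᶠ c : ℝ in 𝓝[>] 0, 0 < c := self_mem_nhdsWithin
  obtain ⟨c, h0, h1, h2, h3⟩ := (hpos.and
    ((hlin.eventually_le_const (u := 1 / 2) (by norm_num)).and
    (((hlim ((j + 2) * 10 ^ (j + 1))).eventually_le_const (u := 1 / 2) (by norm_num)).and
    ((hlim ((j + 2) * 10 ^ (j + 1) * 10 ^ (j + 2))).eventually_le_const
      (u := 1 / (8 * 2 ^ (j + 2))) (by positivity))))).exists
  refine ⟨c, h0, ?_, h1, h2, by rwa [mul_assoc]⟩
  have : 0 ≤ c * j := by positivity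
  linarith

end Parameters

section DataNorms

variable {d : ℕ}

lemma memFLPair_of_integrable {F G : Edim d → ℂ} (hFm : Measurable F) (hGm : Measurable G)
    (hF : Integrable F) (hG : Integrable G) : MemFLPair d F G := by
  refine ⟨hFm, hGm, ENNReal.add_lt_top.mpr ⟨?_, lt_of_le_of_lt ?_ hG.2⟩⟩
  · exact hF.2
  · refine lintegral_mono fun ξ => ?_
    rw [← ofReal_norm]
    refine ENNReal.ofReal_le_ofReal (mul_le_of_le_one_left (norm_nonneg _) ?_)
    exact Real.rpow_le_one_of_one_le_of_nonpos (by nlinarith [norm_nonneg ξ]) (by norm_num)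

lemma lt_HsNorm_of_lt_HsNormSq {s a : ℝ} (ha : 0 ≤ a) {F : Edim d → ℂ}
    (h : ENNReal.ofReal (a ^ 2) < HsNormSq d s F) : ENNReal.ofReal a < HsNorm d s F := by
  have e : ENNReal.ofReal a = ENNReal.ofReal (a ^ 2) ^ (1 / 2 : ℝ) := by
    rw [ENNReal.ofReal_rpow_of_nonneg (by positivity) (by norm_num), ← Real.sqrt_eq_rpow,
      Real.sqrt_sq ha]
  rw [e]
  exact ENNReal.rpow_lt_rpow h (by norm_num)

lemma pairHsNorm_zero_right_lt {s a : ℝ} (ha : 0 ≤ a) {F : Edim d → ℂ}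
    (h : HsNormSq d s F < ENNReal.ofReal (a ^ 2)) :
    pairHsNorm d s F (fun _ => 0) < ENNReal.ofReal a := by
  have e : ENNReal.ofReal a = ENNReal.ofReal (a ^ 2) ^ (1 / 2 : ℝ) := by
    rw [ENNReal.ofReal_rpow_of_nonneg (by positivity) (by norm_num), ← Real.sqrt_eq_rpow,
      Real.sqrt_sq ha]
  have h0 : HsNormSq d (s - 1) (fun _ => 0) = 0 := by simp [HsNormSq]
  rw [e, pairHsNorm, h0, add_zero]
  exact ENNReal.rpow_lt_rpow h (by norm_num)

end DataNorms

lemma regularity_lt_of_cond {d k : ℕ} (hd : 1 ≤ d) {s : ℝ}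
    (hcond : (-(d : ℝ) / 2 < s ∧ s < min ((d : ℝ) / 2 - 2 / ((k : ℝ) - 1)) 0 ∧
        1 + 2 / (d : ℝ) < (k : ℝ)) ∨ (s ≤ -(d : ℝ) / 2 ∧ 5 ≤ k)) :
    s < 0 ∧ s < (d : ℝ) / 2 - 2 / ((k : ℝ) - 1) := by
  have hd' : (1 : ℝ) ≤ d := by exact_mod_cast hd
  rcases hcond with ⟨-, h, -⟩ | ⟨h, hk⟩
  · exact ⟨(lt_min_iff.mp h).2, (lt_min_iff.mp h).1⟩
  · have hk' : (5 : ℝ) ≤ k := by exact_mod_cast hk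
    have : 2 / ((k : ℝ) - 1) ≤ 1 / 2 := by
      rw [div_le_iff₀ (by linarith)]
      linarith
    constructor <;> linarith

/-- Proposition 3.1: norm inflation at general (Schwartz) initial
data, in the regimes `(-d/2 < s < min(s_scal,0), k > 1 + 2/d)` or `(s ≤ -d/2, k ≥ 5)`.
(Schwartz data are represented on the Fourier side: `F₀ = û₀`, `F₁ = û₁`.) -/
theorem norm_inflation_schwartz_data
    (d k : ℕ) (hd : 1 ≤ d) (hk : 2 ≤ k) (s : ℝ)
    (hcond : (-(d : ℝ) / 2 < s ∧ s < min ((d : ℝ) / 2 - 2 / ((k : ℝ) - 1)) 0 ∧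
        1 + 2 / (d : ℝ) < (k : ℝ)) ∨ (s ≤ -(d : ℝ) / 2 ∧ 5 ≤ k))
    (F₀ F₁ : SchwartzMap (Edim d) ℂ) :
    ∀ n : ℕ, 0 < n →
      ∃ (G₀ G₁ : Edim d → ℂ) (T : ℝ) (u : ℝ → Edim d → ℂ) (tn : ℝ),
        MemFLPair d G₀ G₁ ∧ 0 < T ∧ IsDuhamelSolution d k T G₀ G₁ u ∧
        tn ∈ Set.Ioo 0 (1 / (n : ℝ)) ∧ tn ≤ T ∧
        pairHsNorm d s (fun ξ => G₀ ξ - F₀ ξ) (fun ξ => G₁ ξ - F₁ ξ) <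
            ENNReal.ofReal (1 / (n : ℝ)) ∧
        ENNReal.ofReal (n : ℝ) < HsNorm d s (u tn) := by
  intro m hm
  obtain ⟨j, rfl⟩ : ∃ j, k = j + 2 := ⟨k - 2, by omega⟩
  obtain ⟨hs, hsk⟩ := regularity_lt_of_cond hd hcond
  have hkj : (((j + 2 : ℕ) : ℝ) - 1) = ((j + 1 : ℕ) : ℝ) := by push_cast; ring
  rw [hkj] at hsk
  have hm' : (1 : ℝ) ≤ m := by exact_mod_cast hm
  have i₀ : Integrable F₀ := F₀.integrable
  have i₁ : Integrable F₁ := F₁.integrable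
  obtain ⟨c, hc, hc1, hcj, hc2, hc3⟩ := exists_small_time_constant j
  set C : ℝ := 2 * (∫ ξ, ‖F₀ ξ‖) + ∫ ξ, ‖F₁ ξ‖ with hC
  have hC0 : 0 ≤ C := add_nonneg (mul_nonneg zero_le_two
    (integral_nonneg fun _ => norm_nonneg _)) (integral_nonneg fun _ => norm_nonneg _)
  set v : ℝ := volume.real (Metric.closedBall (0 : Edim d) 1) with hv
  have hv0 : 0 < v := measureReal_closedBall_pos 0 one_pos
  set γ : ℝ := c ^ 2 / (16 * 2 ^ (j + 2)) with hγ
  have hγ0 : 0 < γ := by positivity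
  set κ : ℝ := (2 * ((j : ℝ) + 2) ^ 2) ^ s * (γ ^ 2 / (((j : ℝ) + 2) ^ d * v)) with hκ
  have hκ0 : 0 < κ := by positivity
  set μ : ℝ := (1 / 2 : ℝ) ^ (2 * s) * (4 / v) with hμ
  have hμ0 : 0 < μ := by positivity
  obtain ⟨K, hKm, hKj, hKC, hKγ, hKκ, hKμ⟩ :
      ∃ K : ℝ, m + 1 ≤ K ∧ (j : ℝ) + 4 ≤ K ∧ C ≤ K ∧ 2 * C / γ ≤ K ∧
      (m ^ 2 + 1) / κ ≤ K ∧ μ * m ^ 2 + 1 ≤ K :=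
    ((eventually_ge_atTop ((m : ℝ) + 1)).and
      ((eventually_ge_atTop ((j : ℝ) + 4)).and ((eventually_ge_atTop C).and
      ((eventually_ge_atTop (2 * C / γ)).and ((eventually_ge_atTop (((m : ℝ) ^ 2 + 1) / κ)).and
      (eventually_ge_atTop (μ * m ^ 2 + 1))))))).exists
  have hK0 : 0 < K := by linarith
  obtain ⟨N, M, A, hA, hKM, hKA, hMN, hbig, hsmall⟩ :=
    exists_parameters hd (Nat.le_add_left 1 j) hs hsk hK0
  have hA0 : 0 < A := by linarith
  have hKN : K ≤ N := (le_mul_of_one_le_right hK0.le hA).trans hKA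
  have hN0 : 0 < N := by linarith
  have hNA : ((j : ℝ) + 4) * A ≤ N := (mul_le_mul_of_nonneg_right hKj hA0.le).trans hKA
  have hM0 : 0 ≤ M := by linarith
  have hjA : 0 ≤ (j : ℝ) * A := by positivity
  have hjN : 0 ≤ (j : ℝ) * N := by positivity
  let e : Edim d := EuclideanSpace.single ⟨0, hd⟩ 1
  have he : ‖e‖ = 1 := by simp [e]
  obtain ⟨φ, hφ⟩ : ∃ φ : Edim d → ℝ,
      φ = fun ξ => bump (N • e) A M ξ + bump (-((j + 1) * N) • e) A M ξ := ⟨_, rfl⟩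
  have hφm : Measurable φ := by
    rw [hφ]
    exact (measurable_bump _ _ _).add (measurable_bump _ _ _)
  have iφ : Integrable φ := by
    rw [hφ]
    exact (integrable_bump _ _ _).add (integrable_bump _ _ _)
  obtain ⟨u, hu, iu, hlow⟩ := exists_solution_large_low_frequency hd j i₀ i₁ hc hcj hc2 le_rfl hA0
    (by linarith) hNA hMN (hKC.trans hKM) he hφ
  have hT : 0 < c / N := by positivity
  refine ⟨fun ξ => F₀ ξ + φ ξ, F₁, c / N, u, c / N, ?_, hT, hu, ⟨hT, ?_⟩, le_rfl, ?_, ?_⟩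
  · exact memFLPair_of_integrable
      (F₀.continuous.measurable.add (Complex.measurable_ofReal.comp hφm)) F₁.continuous.measurable
      (i₀.add iφ.ofReal) i₁
  · rw [div_lt_div_iff₀ hN0 (by linarith)]
    nlinarith
  · have nx : N / 2 + A ≤ ‖N • e‖ := by
      rw [norm_smul, he, mul_one, Real.norm_of_nonneg hN0.le]
      linarith
    have ny : N / 2 + A ≤ ‖-((j + 1) * N) • e‖ := by
      rw [norm_smul, he, mul_one, norm_neg, Real.norm_of_nonneg (by positivity)]
      linarith
    have hle := HsNormSq_bump_add_bump_le hs.le hA0 (half_pos hN0) nx ny M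
    simp only [add_sub_cancel_left, sub_self]
    refine pairHsNorm_zero_right_lt (by positivity) ?_
    rw [hφ]
    refine hle.trans_lt ((ENNReal.ofReal_lt_ofReal_iff (by positivity)).mpr ?_)
    calc (N / 2) ^ (2 * s) * (4 * M ^ 2 / (A ^ d * v))
        = μ * (N ^ (2 * s) * M ^ 2 / A ^ d) := by
          rw [div_eq_mul_one_div N, Real.mul_rpow hN0.le (by norm_num), hμ]
          field_simp
      _ ≤ μ * (1 / K) := by gcongr
      _ < (1 / m) ^ 2 := by
          rw [mul_one_div, div_pow, one_pow, div_lt_div_iff₀ hK0 (by positivity)]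
          linarith
  · have hI : γ * M ≤ ∫ ξ in Metric.closedBall 0 ((j + 2) * A), ‖u (c / N) ξ‖ := by
      have hCM : 2 * C ≤ γ * M := by
        rw [mul_comm γ]
        exact (div_le_iff₀ hγ0).mp (hKγ.trans hKM)
      have e1 : c ^ 2 / 4 * (M / 2 ^ (j + 2)) = 4 * (γ * M) := by
        rw [hγ]
        field_simp
        ring
      have e2 : c ^ 2 * ((j + 2) * 10 ^ (j + 1)) * (c ^ 2 * (10 ^ (j + 2) * M)) ≤ 2 * (γ * M) := by
        calc _ = (c ^ 2 * ((j + 2) * 10 ^ (j + 1)) * 10 ^ (j + 2)) * (c ^ 2 * M) := by ring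
          _ ≤ (1 / (8 * 2 ^ (j + 2))) * (c ^ 2 * M) := by gcongr
          _ = _ := by
            rw [hγ]
            field_simp
            ring
      have e3 := mul_le_mul_of_nonneg_right hc2 hC0
      rw [e1, mul_add] at hlow
      linarith
    have hr1 : 1 ≤ ((j : ℝ) + 2) * A := by linarith
    have hge := le_HsNormSq hs.le hr1 iu
    refine lt_HsNorm_of_lt_HsNormSq (Nat.cast_nonneg m) (lt_of_lt_of_le ?_ hge)
    refine (ENNReal.ofReal_lt_ofReal_iff_of_nonneg (by positivity)).mpr ?_
    calc (m : ℝ) ^ 2 < κ * K := by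
          have := (div_le_iff₀ hκ0).mp hKκ
          linarith
      _ ≤ κ * (M ^ 2 * A ^ (2 * s) / A ^ d) := by gcongr
      _ = (2 * ((j + 2) * A) ^ 2) ^ s * ((γ * M) ^ 2 / (((j + 2) * A) ^ d * v)) := by
          rw [mul_pow _ A, ← mul_assoc, Real.mul_rpow (by positivity) (by positivity),
            Real.rpow_mul hA0.le, Real.rpow_two, mul_pow _ A, hκ]
          field_simp
      _ ≤ _ := by gcongr

end
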